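/- arXiv:1710.03982 — 4 statements merged into one kernel-verified Lean document; each statement's English description precedes it below -/
import Mathlib

section
/- The prime number theorem: as the real variable x tends to infinity, π(x) · ln x / x → 1; that is, the prime counting function is asymptotic to x / ln x. -/
open MeasureTheory Filter Set Topology

theorem integrable_sinc_sq : Integrable fun x : ℝ => Real.sinc x ^ 2 := by
  refine (integrable_inv_one_add_sq.const_mul 2).mono'
    (Real.continuous_sinc.pow 2).aestronglyMeasurable (Eventually.of_forall fun x => ?_)
  rw [Real.norm_of_nonneg (sq_nonneg _), ← div_eq_mul_inv, le_div_iff₀ (by positivity)]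
  have h1 : Real.sinc x ^ 2 ≤ 1 := by
    rw [sq_le_one_iff_abs_le_one]
    exact abs_le.2 ⟨Real.neg_one_le_sinc x, Real.sinc_le_one x⟩
  have h2 : Real.sinc x ^ 2 * x ^ 2 ≤ 1 := by
    rcases eq_or_ne x 0 with rfl | hx
    · simp
    · rw [Real.sinc_of_ne_zero hx, ← mul_pow, div_mul_cancel₀ _ hx]
      exact Real.sin_sq_le_one x
  linarith

theorem integral_one_sub_mul_cexp {c : ℂ} (hc : c ≠ 0) :
    ∫ y in (0 : ℝ)..1, (1 - (y : ℂ)) * Complex.exp (c * y) =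
      (Complex.exp c - 1 - c) / c ^ 2 := by
  have hd (y : ℝ) : HasDerivAt
      (fun y : ℝ => (1 - (y : ℂ)) * Complex.exp (c * y) / c + Complex.exp (c * y) / c ^ 2)
      ((1 - (y : ℂ)) * Complex.exp (c * y)) y := by
    have hy : HasDerivAt (fun y : ℝ => (y : ℂ)) 1 y := Complex.ofRealCLM.hasDerivAt
    have he := (hy.const_mul c).cexp
    refine ((((hy.const_sub 1).mul he).div_const c).add (he.div_const (c ^ 2))).congr_deriv ?_
    field_simp
    ring
  rw [intervalIntegral.integral_eq_sub_of_hasDerivAt (fun y _ => hd y)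
    (Continuous.intervalIntegrable (by fun_prop) _ _)]
  simp
  field_simp
  ring

/-- The Fourier transform of the triangle function is the Fejér kernel. -/
theorem integral_triangle_mul_cexp (u : ℝ) :
    ∫ y in (-1 : ℝ)..1, (1 - ((|y| : ℝ) : ℂ)) * Complex.exp (-(2 * u * Complex.I) * y) =
      ((Real.sinc u ^ 2 : ℝ) : ℂ) := by
  have hneg (c : ℂ) : ∫ y in (-1 : ℝ)..0, (1 - ((|y| : ℝ) : ℂ)) * Complex.exp (c * y) =
      ∫ y in (0 : ℝ)..1, (1 - (y : ℂ)) * Complex.exp (-c * y) := by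
    rw [← neg_zero, ← intervalIntegral.integral_comp_neg, neg_zero]
    refine intervalIntegral.integral_congr fun y hy => ?_
    rw [uIcc_of_le zero_le_one] at hy
    simp [abs_of_nonneg hy.1]
  have hpos (c : ℂ) : ∫ y in (0 : ℝ)..1, (1 - ((|y| : ℝ) : ℂ)) * Complex.exp (c * y) =
      ∫ y in (0 : ℝ)..1, (1 - (y : ℂ)) * Complex.exp (c * y) := by
    refine intervalIntegral.integral_congr fun y hy => ?_
    rw [uIcc_of_le zero_le_one] at hy
    simp [abs_of_nonneg hy.1]
  rw [← intervalIntegral.integral_add_adjacent_intervals (b := 0)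
    (Continuous.intervalIntegrable (by fun_prop) _ _)
    (Continuous.intervalIntegrable (by fun_prop) _ _), hneg, hpos]
  rcases eq_or_ne u 0 with rfl | hu
  · have h : ∫ y in (0 : ℝ)..1, (1 - (y : ℂ)) = 1 / 2 := by
      have : ∫ y in (0 : ℝ)..1, (1 - y) = 1 / 2 := by
        rw [intervalIntegral.integral_sub (by simp) (by simp)]
        norm_num [integral_id]
      rw [← Complex.ofReal_inj, ← intervalIntegral.integral_ofReal] at this
      simpa using this
    simp only [Complex.ofReal_zero, mul_zero, zero_mul, neg_zero, Complex.exp_zero, mul_one, h]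
    norm_num
  · have hu' : (u : ℂ) ≠ 0 := by exact_mod_cast hu
    have hc : 2 * (u : ℂ) * Complex.I ≠ 0 := by simp [hu]
    rw [integral_one_sub_mul_cexp (neg_ne_zero.2 (neg_ne_zero.2 hc)),
      integral_one_sub_mul_cexp (neg_ne_zero.2 hc), Real.sinc_of_ne_zero hu]
    have hs : (Complex.sin u) ^ 2 =
        -(Complex.exp (2 * u * Complex.I) + Complex.exp (-(2 * u * Complex.I)) - 2) / 4 := by
      rw [Complex.sin, div_pow, mul_pow, Complex.I_sq, sub_sq, ← Complex.exp_nat_mul,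
        ← Complex.exp_nat_mul, mul_assoc 2 (Complex.exp _), ← Complex.exp_add]
      have : -(u : ℂ) * Complex.I + u * Complex.I = 0 := by ring
      rw [this, Complex.exp_zero]
      push_cast
      ring_nf
    push_cast
    rw [div_pow, hs, neg_neg, neg_sq, mul_pow, Complex.I_sq]
    field_simp
    ring

/-- Smoothing a Laplace transform by the Fejér kernel. -/
theorem integral_mul_exp_mul_sinc_sq {f : ℝ → ℝ} {M : ℝ} {G : ℂ → ℂ} (hf : Measurable f)
    (hM : ∀ u, |f u| ≤ M)
    (hG : ∀ z : ℂ, 0 < z.re → ∫ u in Ioi (0 : ℝ), (f u : ℂ) * Complex.exp (-z * u) = G z)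
    {ε : ℝ} (hε : 0 < ε) (a x : ℝ) :
    ∫ u in Ioi (0 : ℝ), ((f u * Real.exp (-ε * u) * Real.sinc (a * (u - x)) ^ 2 : ℝ) : ℂ) =
      ∫ y in (-1 : ℝ)..1, (1 - ((|y| : ℝ) : ℂ)) * Complex.exp (2 * a * x * y * Complex.I) *
        G (ε + 2 * a * y * Complex.I) := by
  let F : ℝ → ℝ → ℂ := fun y u => (f u : ℂ) * Complex.exp (-ε * u) *
    ((1 - ((|y| : ℝ) : ℂ)) * Complex.exp (-(2 * (a * (u - x) : ℝ) * Complex.I) * y))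
  have hF : Integrable (Function.uncurry F)
      ((volume.restrict (uIoc (-1 : ℝ) 1)).prod (volume.restrict (Ioi (0 : ℝ)))) := by
    have h1 : Integrable (fun _ : ℝ => (1 : ℝ)) (volume.restrict (uIoc (-1 : ℝ) 1)) := by
      rw [uIoc_of_le (by norm_num)]
      exact integrable_const _
    have h2 := (exp_neg_integrableOn_Ioi 0 hε).const_mul M
    refine (h1.mul_prod h2).mono' (by fun_prop) ?_
    rw [Measure.prod_restrict]
    refine (ae_restrict_iff' (measurableSet_uIoc.prod measurableSet_Ioi)).2
      (Eventually.of_forall ?_)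
    rintro ⟨y, u⟩ ⟨hy, -⟩
    rw [uIoc_of_le (by norm_num)] at hy
    have hy' : |y| ≤ 1 := abs_le.2 ⟨hy.1.le, hy.2⟩
    have e1 : ‖Complex.exp (-ε * u)‖ = Real.exp (-ε * u) := by
      rw [Complex.norm_exp]; simp
    have e2 : ‖Complex.exp (-(2 * (a * (u - x) : ℝ) * Complex.I) * y)‖ = 1 := by
      rw [Complex.norm_exp]; simp
    have e3 : ‖(1 : ℂ) - ((|y| : ℝ) : ℂ)‖ ≤ 1 := by
      rw [← Complex.ofReal_one, ← Complex.ofReal_sub, Complex.norm_real,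
        Real.norm_of_nonneg (by linarith)]
      linarith [abs_nonneg y]
    simp only [Function.uncurry_apply_pair, F, norm_mul, e1, e2, Complex.norm_real, mul_one,
      one_mul, Real.norm_eq_abs]
    calc |f u| * Real.exp (-ε * u) * _ ≤ M * Real.exp (-ε * u) * 1 := by
          gcongr
          · exact mul_nonneg ((abs_nonneg _).trans (hM u)) (Real.exp_pos _).le
          · exact hM u
      _ = _ := mul_one _
  calc _ = ∫ u in Ioi (0 : ℝ), ∫ y in (-1 : ℝ)..1, F y u := by
        refine integral_congr_ae (Eventually.of_forall fun u => ?_)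
        simp only [F]
        rw [intervalIntegral.integral_const_mul, integral_triangle_mul_cexp]
        push_cast
        rfl
    _ = ∫ y in (-1 : ℝ)..1, ∫ u in Ioi (0 : ℝ), F y u :=
        (intervalIntegral_integral_swap hF).symm
    _ = _ := by
        refine intervalIntegral.integral_congr fun y _ => ?_
        rw [← hG _ (by simpa using hε), ← integral_const_mul]
        refine integral_congr_ae (Eventually.of_forall fun u => ?_)
        simp only [F]
        have : Complex.exp (-ε * u) * Complex.exp (-(2 * (a * (u - x) : ℝ) * Complex.I) * y) =
            Complex.exp (2 * a * x * y * Complex.I) *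
              Complex.exp (-(ε + 2 * a * y * Complex.I) * u) := by
          rw [← Complex.exp_add, ← Complex.exp_add]
          congr 1
          push_cast
          ring
        linear_combination ((f u : ℂ) * (1 - ((|y| : ℝ) : ℂ))) * this

theorem integral_mul_sinc_sq {f : ℝ → ℝ} {M : ℝ} {G : ℂ → ℂ} (hf : Measurable f)
    (hM : ∀ u, |f u| ≤ M)
    (hG : ∀ z : ℂ, 0 < z.re → ∫ u in Ioi (0 : ℝ), (f u : ℂ) * Complex.exp (-z * u) = G z)
    (hGc : ContinuousOn G {z | 0 ≤ z.re}) {a : ℝ} (ha : 0 < a) (x : ℝ) :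
    ∫ u in Ioi (0 : ℝ), ((f u * Real.sinc (a * (u - x)) ^ 2 : ℝ) : ℂ) =
      ∫ y in (-1 : ℝ)..1, (1 - ((|y| : ℝ) : ℂ)) * Complex.exp (2 * a * x * y * Complex.I) *
        G (2 * a * y * Complex.I) := by
  have hL : Tendsto (fun ε : ℝ => ∫ u in Ioi (0 : ℝ),
        ((f u * Real.exp (-ε * u) * Real.sinc (a * (u - x)) ^ 2 : ℝ) : ℂ)) (𝓝[>] 0)
      (𝓝 (∫ u in Ioi (0 : ℝ), ((f u * Real.sinc (a * (u - x)) ^ 2 : ℝ) : ℂ))) := by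
    refine tendsto_integral_filter_of_dominated_convergence
      (fun u => M * Real.sinc (a * (u - x)) ^ 2) (Eventually.of_forall fun ε => ?_) ?_
      (((integrable_sinc_sq.comp_mul_left' ha.ne').comp_sub_right x).const_mul M).integrableOn
      (Eventually.of_forall fun u => ?_)
    · have := Real.continuous_sinc
      fun_prop
    · filter_upwards [self_mem_nhdsWithin] with ε hε
      refine (ae_restrict_iff' measurableSet_Ioi).2 (Eventually.of_forall fun u hu => ?_)
      rw [Complex.norm_real, norm_mul, norm_mul, Real.norm_eq_abs, Real.norm_of_nonneg (sq_nonneg _),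
        Real.norm_of_nonneg (Real.exp_pos _).le]
      gcongr
      have h : Real.exp (-ε * u) ≤ 1 := by
        rw [Real.exp_le_one_iff]
        have := mul_pos (show (0 : ℝ) < ε from hε) (show (0 : ℝ) < u from hu)
        linarith
      calc _ ≤ |f u| * 1 := by gcongr
        _ ≤ M := by simpa using hM u
    · have hc : Continuous fun ε : ℝ =>
          ((f u * Real.exp (-ε * u) * Real.sinc (a * (u - x)) ^ 2 : ℝ) : ℂ) := by fun_prop
      simpa using (hc.tendsto 0).mono_left nhdsWithin_le_nhds
  obtain ⟨C, hC⟩ : ∃ C, ∀ ε ∈ Icc (0 : ℝ) 1, ∀ y ∈ Icc (-1 : ℝ) 1,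
      ‖G (ε + 2 * a * y * Complex.I)‖ ≤ C := by
    obtain ⟨C, hC⟩ := (isCompact_Icc.prod isCompact_Icc :
      IsCompact (Icc (0 : ℝ) 1 ×ˢ Icc (-1 : ℝ) 1)).exists_bound_of_continuousOn
      (f := fun p : ℝ × ℝ => G (p.1 + 2 * a * p.2 * Complex.I))
      (hGc.comp (Continuous.continuousOn (by fun_prop)) fun p hp => by simpa using hp.1.1)
    exact ⟨C, fun ε hε y hy => hC (ε, y) ⟨hε, hy⟩⟩
  have hmeas (ε : ℝ) (hε : 0 ≤ ε) : Continuous fun y : ℝ => G (ε + 2 * a * y * Complex.I) :=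
    hGc.comp_continuous (by fun_prop) fun y => by simpa using hε
  have hR : Tendsto (fun ε : ℝ => ∫ y in (-1 : ℝ)..1, (1 - ((|y| : ℝ) : ℂ)) *
        Complex.exp (2 * a * x * y * Complex.I) * G (ε + 2 * a * y * Complex.I)) (𝓝[>] 0)
      (𝓝 (∫ y in (-1 : ℝ)..1, (1 - ((|y| : ℝ) : ℂ)) *
        Complex.exp (2 * a * x * y * Complex.I) * G (2 * a * y * Complex.I))) := by
    refine intervalIntegral.tendsto_integral_filter_of_dominated_convergence (fun _ => C)
      ?_ ?_ (by simp) (Eventually.of_forall fun y _ => ?_)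
    · filter_upwards [self_mem_nhdsWithin] with ε hε
      have := hmeas ε (le_of_lt hε)
      exact Continuous.aestronglyMeasurable (Continuous.mul (by fun_prop) this)
    · filter_upwards [Ioc_mem_nhdsGT (zero_lt_one' ℝ)] with ε hε
      refine Eventually.of_forall fun y hy => ?_
      rw [uIoc_of_le (by norm_num)] at hy
      have hy' : |y| ≤ 1 := abs_le.2 ⟨hy.1.le, hy.2⟩
      have e2 : ‖Complex.exp (2 * a * x * y * Complex.I)‖ = 1 := by
        rw [Complex.norm_exp]; simp
      have e3 : ‖(1 : ℂ) - ((|y| : ℝ) : ℂ)‖ ≤ 1 := by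
        rw [← Complex.ofReal_one, ← Complex.ofReal_sub, Complex.norm_real,
          Real.norm_of_nonneg (by linarith)]
        linarith [abs_nonneg y]
      rw [norm_mul, norm_mul, e2, mul_one, ← one_mul C]
      gcongr
      exact hC ε ⟨hε.1.le, hε.2⟩ y ⟨hy.1.le, hy.2⟩
    · refine Tendsto.const_mul _ ?_
      have h0 := hGc (2 * a * y * Complex.I) (by simp)
      refine h0.tendsto.comp (tendsto_nhdsWithin_iff.2 ⟨?_, ?_⟩)
      · have hc : Continuous fun ε : ℝ => (ε : ℂ) + 2 * a * y * Complex.I := by fun_prop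
        simpa using (hc.tendsto 0).mono_left nhdsWithin_le_nhds
      · filter_upwards [self_mem_nhdsWithin] with ε hε
        simpa using le_of_lt (show (0 : ℝ) < ε from hε)
  refine tendsto_nhds_unique hL (hR.congr' ?_)
  filter_upwards [self_mem_nhdsWithin] with ε hε
  exact (integral_mul_exp_mul_sinc_sq hf hM hG hε a x).symm

theorem tendsto_integral_mul_sinc_sq {f : ℝ → ℝ} {M : ℝ} {G : ℂ → ℂ} (hf : Measurable f)
    (hM : ∀ u, |f u| ≤ M)
    (hG : ∀ z : ℂ, 0 < z.re → ∫ u in Ioi (0 : ℝ), (f u : ℂ) * Complex.exp (-z * u) = G z)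
    (hGc : ContinuousOn G {z | 0 ≤ z.re}) {a : ℝ} (ha : 0 < a) :
    Tendsto (fun x : ℝ => ∫ u in Ioi (0 : ℝ), f u * Real.sinc (a * (u - x)) ^ 2) atTop (𝓝 0) := by
  let g : ℝ → ℂ := (Ioc (-1 : ℝ) 1).indicator fun y =>
    (1 - ((|y| : ℝ) : ℂ)) * G (2 * a * y * Complex.I)
  have hw : Tendsto (fun x : ℝ => -(a / Real.pi) * x) atTop (cocompact ℝ) :=
    (tendsto_id.const_mul_atTop_of_neg (neg_lt_zero.2 (by positivity))).mono_right
      atBot_le_cocompact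
  have h := (Real.tendsto_integral_exp_smul_cocompact g).comp hw
  rw [← Complex.ofReal_zero] at h
  suffices hs : Tendsto (fun x : ℝ =>
      ((∫ u in Ioi (0 : ℝ), f u * Real.sinc (a * (u - x)) ^ 2 : ℝ) : ℂ)) atTop (𝓝 ((0 : ℝ) : ℂ)) by
    exact (Complex.continuous_re.tendsto _).comp hs
  refine h.congr fun x => ?_
  rw [← integral_complex_ofReal, integral_mul_sinc_sq hf hM hG hGc ha x,
    intervalIntegral.integral_of_le (by norm_num), ← integral_indicator measurableSet_Ioc]
  refine integral_congr_ae (Eventually.of_forall fun y => ?_)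
  by_cases hy : y ∈ Ioc (-1 : ℝ) 1
  · simp only [g, indicator_of_mem hy, Circle.smul_def, Real.fourierChar_apply, smul_eq_mul]
    have : ((2 * Real.pi * -(y * (-(a / Real.pi) * x)) : ℝ) : ℂ) * Complex.I =
        2 * a * x * y * Complex.I := by
      have hpi : (Real.pi : ℂ) ≠ 0 := by exact_mod_cast Real.pi_ne_zero
      push_cast
      field_simp
    rw [this]
    ring
  · simp [g, indicator_of_notMem hy]

theorem eventually_exists_lt_of_tendsto_integral_mul_sinc_sq {f : ℝ → ℝ} {M : ℝ}
    (hf : Measurable f) (hM : ∀ u, |f u| ≤ M)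
    (hK : ∀ a > 0, Tendsto (fun x : ℝ => ∫ u in Ioi (0 : ℝ), f u * Real.sinc (a * (u - x)) ^ 2)
      atTop (𝓝 0)) {δ η : ℝ} (hδ : 0 < δ) (hη : 0 < η) :
    ∀ᶠ x in atTop, ∃ u ∈ Icc (x - η) (x + η), f u < δ := by
  have hM0 : 0 ≤ M := (abs_nonneg _).trans (hM 0)
  set I : ℝ := ∫ v, Real.sinc v ^ 2 with hI
  have hIpos : 0 < I := integral_pos_of_integrable_nonneg_nonzero
    (Real.continuous_sinc.pow 2) (x := 0) integrable_sinc_sq (fun _ => sq_nonneg _) (by simp)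
  have hlim : Tendsto (fun R : ℝ => (δ + M) * (∫ v in (-R)..R, Real.sinc v ^ 2) - M * I) atTop
      (𝓝 ((δ + M) * I - M * I)) :=
    ((intervalIntegral_tendsto_integral integrable_sinc_sq tendsto_neg_atTop_atBot
      tendsto_id).const_mul _).sub_const _
  have hpos : 0 < (δ + M) * I - M * I := by nlinarith
  obtain ⟨R, hRpos, hR⟩ := ((hlim.eventually (lt_mem_nhds hpos)).and (eventually_gt_atTop 0)).exists
  have ha : 0 < R / η := by positivity
  filter_upwards [(hK _ ha).eventually (gt_mem_nhds (mul_pos (inv_pos.2 ha) hRpos)),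
    eventually_gt_atTop η] with x hx hxη
  by_contra! hcon
  have hfi : Integrable fun u : ℝ => Real.sinc (R / η * (u - x)) ^ 2 :=
    (integrable_sinc_sq.comp_mul_left' ha.ne').comp_sub_right x
  have htot : ∫ u, Real.sinc (R / η * (u - x)) ^ 2 = (R / η)⁻¹ * I := by
    rw [integral_sub_right_eq_self (fun u => Real.sinc (R / η * u) ^ 2) x,
      Measure.integral_comp_mul_left (fun u => Real.sinc u ^ 2), abs_of_pos (inv_pos.2 ha),
      smul_eq_mul]
  have hloc : ∫ u in Ioc (x - η) (x + η), Real.sinc (R / η * (u - x)) ^ 2 =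
      (R / η)⁻¹ * ∫ v in (-R)..R, Real.sinc v ^ 2 := by
    rw [← intervalIntegral.integral_of_le (by linarith),
      intervalIntegral.integral_comp_sub_right (fun u => Real.sinc (R / η * u) ^ 2),
      intervalIntegral.integral_comp_mul_left (fun u => Real.sinc u ^ 2) ha.ne', smul_eq_mul]
    congr 2 <;> field_simp <;> ring
  have hsub : Ioc (x - η) (x + η) ⊆ Ioi 0 := fun u hu => by
    have := hu.1
    simp only [mem_Ioi]
    linarith
  have hle : ∫ u in Ioi (0 : ℝ), ((Ioc (x - η) (x + η)).indicator
        (fun u => (δ + M) * Real.sinc (R / η * (u - x)) ^ 2) u -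
        M * Real.sinc (R / η * (u - x)) ^ 2) ≤
      ∫ u in Ioi (0 : ℝ), f u * Real.sinc (R / η * (u - x)) ^ 2 := by
    refine integral_mono
      (((hfi.const_mul _).indicator measurableSet_Ioc).sub (hfi.const_mul M)).integrableOn
      ?_ fun u => ?_
    · refine ((hfi.const_mul M).mono' ?_ (Eventually.of_forall fun u => ?_)).integrableOn
      · exact hf.aestronglyMeasurable.mul hfi.aestronglyMeasurable
      · rw [norm_mul, Real.norm_eq_abs, Real.norm_of_nonneg (sq_nonneg _)]
        gcongr
        exact hM u
    · have hs := sq_nonneg (Real.sinc (R / η * (u - x)))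
      by_cases hu : u ∈ Ioc (x - η) (x + η)
      · have := hcon u ⟨hu.1.le, hu.2⟩
        simp only [indicator_of_mem hu]
        nlinarith
      · have := (abs_le.1 (hM u)).1
        simp only [indicator_of_notMem hu]
        nlinarith
  rw [integral_sub ((hfi.const_mul _).indicator measurableSet_Ioc).integrableOn
    (hfi.const_mul M).integrableOn, setIntegral_indicator measurableSet_Ioc,
    inter_eq_self_of_subset_right hsub, integral_const_mul, integral_const_mul, hloc] at hle
  have hle' : ∫ u in Ioi (0 : ℝ), Real.sinc (R / η * (u - x)) ^ 2 ≤ (R / η)⁻¹ * I :=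
    htot ▸ setIntegral_le_integral hfi (Eventually.of_forall fun _ => sq_nonneg _)
  have := mul_le_mul_of_nonneg_left hle' hM0
  linarith

/-- A Tauberian theorem of Wiener–Ikehara type: if the Laplace transform of a bounded function `f`
extends continuously to the closed right half-plane and `(f u + 1) * exp u` is nondecreasing, then
`f` tends to `0` at infinity. -/
theorem tendsto_zero_of_continuousOn_laplace {f : ℝ → ℝ} {M : ℝ} {G : ℂ → ℂ} (hf : Measurable f)
    (hM : ∀ u, |f u| ≤ M)
    (hG : ∀ z : ℂ, 0 < z.re → ∫ u in Ioi (0 : ℝ), (f u : ℂ) * Complex.exp (-z * u) = G z)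
    (hGc : ContinuousOn G {z | 0 ≤ z.re})
    (hmono : Monotone fun u => (f u + 1) * Real.exp u) :
    Tendsto f atTop (𝓝 0) := by
  have hK (a : ℝ) (ha : 0 < a) := tendsto_integral_mul_sinc_sq hf hM hG hGc ha
  have hK' (a : ℝ) (ha : 0 < a) : Tendsto
      (fun x : ℝ => ∫ u in Ioi (0 : ℝ), (-f u) * Real.sinc (a * (u - x)) ^ 2) atTop (𝓝 0) := by
    simpa [integral_neg] using (hK a ha).neg
  have hshift (u v : ℝ) (huv : u ≤ v) : (f u + 1) ≤ (f v + 1) * Real.exp (v - u) := by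
    have := hmono huv
    simp only at this
    rwa [Real.exp_sub, ← mul_div_assoc, le_div_iff₀ (Real.exp_pos _)]
  rw [Metric.tendsto_nhds]
  intro e' he'
  set e := min e' (1 / 2) with hedef
  have he : 0 < e := lt_min he' one_half_pos
  have he1 : e ≤ 1 / 2 := min_le_right _ _
  have hexp : 1 - e / 4 ≤ Real.exp (-(e / 4)) := by
    linarith [Real.add_one_le_exp (-(e / 4))]
  have hexp' : Real.exp (-(e / 4)) * Real.exp (e / 4) = 1 := by rw [← Real.exp_add]; simp
  have h1 := eventually_exists_lt_of_tendsto_integral_mul_sinc_sq hf hM hK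
    (half_pos he) (show 0 < e / 8 by positivity)
  have h2 := eventually_exists_lt_of_tendsto_integral_mul_sinc_sq hf.neg
    (fun u => (abs_neg (f u)).trans_le (hM u)) hK' (half_pos he) (show 0 < e / 8 by positivity)
  filter_upwards [(tendsto_atTop_add_const_right _ (e / 8) tendsto_id).eventually h1,
    (tendsto_atTop_add_const_right _ (-(e / 8)) tendsto_id).eventually h2] with x hx1 hx2
  rw [Real.dist_0_eq_abs]
  refine lt_of_lt_of_le ?_ (min_le_left e' (1 / 2))
  rw [← hedef, abs_lt]
  have hE := Real.exp_pos (e / 4)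
  have h5 : (1 - e / 4) * Real.exp (e / 4) ≤ 1 :=
    (mul_le_mul_of_nonneg_right hexp hE.le).trans_eq hexp'
  constructor
  · obtain ⟨u, ⟨hu1, hu2⟩, hu⟩ := hx2
    simp only [id, Pi.neg_apply] at hu1 hu2 hu
    by_contra! hcon
    have h := hshift u x (by linarith)
    have hle : Real.exp (x - u) ≤ Real.exp (e / 4) := Real.exp_le_exp.2 (by linarith)
    have h3 : (f x + 1) * Real.exp (x - u) ≤ (1 - e) * Real.exp (x - u) := by
      gcongr
      linarith
    have h4 : (1 - e) * Real.exp (x - u) ≤ (1 - e) * Real.exp (e / 4) :=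
      mul_le_mul_of_nonneg_left hle (by linarith)
    nlinarith
  · obtain ⟨u, ⟨hu1, hu2⟩, hu⟩ := hx1
    simp only [id] at hu1 hu2
    by_contra! hcon
    have h := hshift x u (by linarith)
    have hle : Real.exp (u - x) ≤ Real.exp (e / 4) := Real.exp_le_exp.2 (by linarith)
    have h3 : (f u + 1) * Real.exp (u - x) ≤ (e / 2 + 1) * Real.exp (e / 4) := by
      gcongr
    have h4 : (e + 1) * (1 - e / 4) ≤ (e / 2 + 1) * Real.exp (e / 4) * (1 - e / 4) :=
      mul_le_mul_of_nonneg_right (by linarith) (by linarith)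
    nlinarith

theorem riemannZeta₁_ne_zero_of_one_le_re {s : ℂ} (hs : 1 ≤ s.re) : riemannZeta₁ s ≠ 0 := by
  rcases eq_or_ne s 1 with rfl | h1
  · simp
  · intro h
    apply riemannZeta_ne_zero_of_one_le_re hs
    rw [riemannZeta_eq_inv_sub_mul h1, h, mul_zero]

theorem LSeries_vonMangoldt_eq_inv_sub_logDeriv {s : ℂ} (hs : 1 < s.re) :
    LSeries (fun n => (ArithmeticFunction.vonMangoldt n : ℂ)) s =
      (s - 1)⁻¹ - deriv riemannZeta₁ s / riemannZeta₁ s := by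
  have h1 : s ≠ 1 := by rintro rfl; simp at hs
  have h1' : s - 1 ≠ 0 := sub_ne_zero.2 h1
  have h2 := riemannZeta₁_ne_zero_of_one_le_re hs.le
  rw [ArithmeticFunction.LSeries_vonMangoldt_eq_deriv_riemannZeta_div hs,
    deriv_riemannZeta_eq_neg_inv_sub_sq_mul_add h1, riemannZeta_eq_inv_sub_mul h1]
  field_simp
  ring

theorem LSeries_vonMangoldt_eq_mul_integral_psi_exp {s : ℂ} (hs : 1 < s.re) :
    LSeries (fun n => (ArithmeticFunction.vonMangoldt n : ℂ)) s =
      s * ∫ u in Ioi (0 : ℝ), (Chebyshev.psi (Real.exp u) : ℂ) * Complex.exp (-s * u) := by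
  have hsum (t : ℝ) : ∑ k ∈ Finset.Icc 1 ⌊t⌋₊, ArithmeticFunction.vonMangoldt k =
      Chebyshev.psi t := rfl
  rw [LSeries_eq_mul_integral_of_nonneg _ zero_le_one hs _
    fun _ => ArithmeticFunction.vonMangoldt_nonneg]
  · congr 1
    have himg : Real.exp '' Ioi 0 = Ioi 1 := by
      ext t
      simp only [mem_image, mem_Ioi]
      refine ⟨?_, fun ht => ⟨Real.log t, Real.log_pos ht, Real.exp_log (by linarith)⟩⟩
      rintro ⟨u, hu, rfl⟩
      exact Real.one_lt_exp_iff.2 hu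
    rw [← himg, integral_image_eq_integral_abs_deriv_smul measurableSet_Ioi
      (fun u _ => (Real.hasDerivAt_exp u).hasDerivWithinAt) Real.exp_injective.injOn]
    refine integral_congr_ae (Eventually.of_forall fun u => ?_)
    simp only
    rw [← Complex.ofReal_sum, hsum, abs_of_pos (Real.exp_pos u), Complex.real_smul,
      Complex.ofReal_exp, Complex.cpow_def_of_ne_zero (Complex.exp_ne_zero _), ← Complex.ofReal_exp,
      ← Complex.ofReal_log (Real.exp_pos u).le, Real.log_exp, Complex.ofReal_exp, mul_left_comm,
      ← Complex.exp_add]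
    ring_nf
  · refine Asymptotics.IsBigO.of_bound (Real.log 4 + 4) (Eventually.of_forall fun n => ?_)
    have h := hsum n
    rw [Nat.floor_natCast] at h
    rw [h, Real.rpow_one, Real.norm_of_nonneg (Chebyshev.psi_nonneg _),
      Real.norm_of_nonneg n.cast_nonneg]
    exact Chebyshev.psi_le_const_mul_self n.cast_nonneg

theorem tendsto_psi_exp_mul_exp_neg_sub_one :
    Tendsto (fun u : ℝ => Chebyshev.psi (Real.exp u) * Real.exp (-u) - 1) atTop (𝓝 0) := by
  have hmeas : Measurable fun u : ℝ => Chebyshev.psi (Real.exp u) * Real.exp (-u) - 1 := by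
    have := Chebyshev.psi_mono.measurable
    fun_prop
  have hbd (u : ℝ) : |Chebyshev.psi (Real.exp u) * Real.exp (-u) - 1| ≤ Real.log 4 + 4 + 1 := by
    have h := mul_le_mul_of_nonneg_right
      (Chebyshev.psi_le_const_mul_self (Real.exp_pos u).le) (Real.exp_pos (-u)).le
    rw [mul_assoc, ← Real.exp_add, add_neg_cancel, Real.exp_zero, mul_one] at h
    have h0 := mul_nonneg (Chebyshev.psi_nonneg (Real.exp u)) (Real.exp_pos (-u)).le
    have h4 := Real.log_nonneg (show (1 : ℝ) ≤ 4 by norm_num)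
    rw [abs_le]
    constructor <;> linarith
  refine tendsto_zero_of_continuousOn_laplace (G := fun z =>
    -(deriv riemannZeta₁ (1 + z) / riemannZeta₁ (1 + z) + 1) / (1 + z)) hmeas hbd ?_ ?_ ?_
  · intro z hz
    have hz0 : z ≠ 0 := by rintro rfl; simp at hz
    have hz1 : 1 + z ≠ 0 := fun h => by
      have := congrArg Complex.re h
      simp at this
      linarith
    have hexp : IntegrableOn (fun u : ℝ => Complex.exp (-z * u)) (Ioi 0) :=
      integrableOn_exp_mul_complex_Ioi (by simpa using hz) 0
    have hfi : IntegrableOn (fun u : ℝ =>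
        ((Chebyshev.psi (Real.exp u) * Real.exp (-u) - 1 : ℝ) : ℂ) * Complex.exp (-z * u))
        (Ioi 0) :=
      Integrable.bdd_mul hexp (Complex.measurable_ofReal.comp hmeas).aestronglyMeasurable
        (Eventually.of_forall fun u => (Complex.norm_real _).trans_le (hbd u))
    have hI := integral_add hfi hexp
    have hL := LSeries_vonMangoldt_eq_mul_integral_psi_exp (s := 1 + z) (by simpa using hz)
    rw [LSeries_vonMangoldt_eq_inv_sub_logDeriv (by simpa using hz)] at hL
    have hcongr : ∫ u in Ioi (0 : ℝ),
        (((Chebyshev.psi (Real.exp u) * Real.exp (-u) - 1 : ℝ) : ℂ) * Complex.exp (-z * u) +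
          Complex.exp (-z * u)) =
        ∫ u in Ioi (0 : ℝ), (Chebyshev.psi (Real.exp u) : ℂ) * Complex.exp (-(1 + z) * u) := by
      refine integral_congr_ae (Eventually.of_forall fun u => ?_)
      have : Complex.exp (-(1 + z) * u) = Complex.exp (-u) * Complex.exp (-z * u) := by
        rw [← Complex.exp_add]
        ring_nf
      simp only [this]
      push_cast
      ring
    rw [hcongr, integral_exp_mul_complex_Ioi (by simpa using hz)] at hI
    rw [hI] at hL
    simp only [Complex.ofReal_zero, mul_zero, Complex.exp_zero, add_sub_cancel_left] at hL
    rw [eq_div_iff hz1]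
    linear_combination -hL - inv_mul_cancel₀ hz0
  · intro z hz
    have hz' : 1 ≤ (1 + z).re := by simpa using hz
    have h1 := riemannZeta₁_ne_zero_of_one_le_re hz'
    have hz1 : 1 + z ≠ 0 := fun h => by
      rw [h] at hz'
      simp at hz'
      linarith
    have hd : Continuous (deriv riemannZeta₁) :=
      (differentiable_riemannZeta₁.contDiff (n := 1)).continuous_deriv le_rfl
    have hc : Continuous riemannZeta₁ := differentiable_riemannZeta₁.continuous
    refine ContinuousAt.continuousWithinAt ?_
    exact ((((hd.comp (continuous_const_add 1)).continuousAt).div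
      (hc.comp (continuous_const_add 1)).continuousAt h1).add_const 1).neg.div
      (continuous_const_add 1).continuousAt hz1
  · intro u v huv
    have h (u : ℝ) : (Chebyshev.psi (Real.exp u) * Real.exp (-u) - 1 + 1) * Real.exp u =
        Chebyshev.psi (Real.exp u) := by
      rw [sub_add_cancel, mul_assoc, ← Real.exp_add, neg_add_cancel, Real.exp_zero, mul_one]
    simp only [h]
    exact Chebyshev.psi_mono (Real.exp_le_exp.2 huv)

theorem tendsto_psi_div_self : Tendsto (fun x : ℝ => Chebyshev.psi x / x) atTop (𝓝 1) := by
  have h := (tendsto_psi_exp_mul_exp_neg_sub_one.add_const 1).comp Real.tendsto_log_atTop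
  rw [zero_add] at h
  refine h.congr' ?_
  filter_upwards [eventually_gt_atTop 0] with x hx
  simp [Real.exp_neg, Real.exp_log hx, div_eq_mul_inv]

theorem tendsto_theta_div_self : Tendsto (fun x : ℝ => Chebyshev.theta x / x) atTop (𝓝 1) := by
  have h : (fun x => Chebyshev.psi x - Chebyshev.theta x) =o[atTop] fun x : ℝ => x := by
    refine Chebyshev.isBigO_psi_sub_theta_sqrt.trans_isLittleO ?_
    rw [Asymptotics.isLittleO_iff_tendsto' (by
      filter_upwards [eventually_ne_atTop 0] with x hx h using absurd h hx)]
    simpa [Real.sqrt_div_self', Function.comp_def] using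
      (tendsto_inv_atTop_zero.comp Real.tendsto_sqrt_atTop)
  have := tendsto_psi_div_self.sub h.tendsto_div_nhds_zero
  rw [sub_zero] at this
  exact this.congr fun x => by ring

/-- The prime number theorem: `π(x) · log x / x → 1` as `x → ∞`, where `π(x)` is the
number of primes `≤ x`. -/
theorem prime_counting_asymptotic :
    Filter.Tendsto (fun x : ℝ => (Nat.primeCounting ⌊x⌋₊ : ℝ) * Real.log x / x)
      Filter.atTop (nhds 1) := by
  obtain ⟨C, hC⟩ := Chebyshev.primeCounting_sub_theta_div_log_isBigO.bound
  have hdiff : Tendsto (fun x : ℝ => (Nat.primeCounting ⌊x⌋₊ : ℝ) * Real.log x / x -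
      Chebyshev.theta x / x) atTop (𝓝 0) := by
    refine squeeze_zero_norm' ?_
      (by simpa using Real.tendsto_log_atTop.inv_tendsto_atTop.const_mul C)
    filter_upwards [hC, eventually_gt_atTop 1] with x hx hx1
    have hx0 : 0 < x := by linarith
    have hl : 0 < Real.log x := Real.log_pos hx1
    rw [Real.norm_of_nonneg (by positivity : 0 ≤ x / Real.log x ^ 2)] at hx
    calc _ = ‖(Nat.primeCounting ⌊x⌋₊ : ℝ) - Chebyshev.theta x / Real.log x‖ *
            (Real.log x / x) := by
          have hnn : 0 ≤ Real.log x / x := by positivity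
          conv_rhs => rw [← Real.norm_of_nonneg hnn, ← norm_mul]
          congr 1
          field_simp
      _ ≤ C * (x / Real.log x ^ 2) * (Real.log x / x) := by gcongr
      _ = _ := by
        field_simp
  simpa using hdiff.add tendsto_theta_div_self
end

section
/- Euler's addition theorem for lemniscatic integrals: let x, y ∈ [0,1) satisfy A(x) + A(y) < A₁, where A₁ denotes the supremum of A over [0,1) (the quarter-period of the lemniscate). Then z := (x·√(1−y⁴) + y·√(1−x⁴)) / (1 + x²y²) lies in [0,1) and A(x) + A(y) = A(z). -/
/-- The lemniscatic arc-length integral `A(x) = ∫₀ˣ dt/√(1-t⁴)` for `x ∈ [0,1)`. -/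
noncomputable def lemniscateA (x : ℝ) : ℝ :=
  ∫ t in (0 : ℝ)..x, 1 / Real.sqrt (1 - t ^ 4)

open Set

lemma one_sub_pow_four_pos {t : ℝ} (ht : t ∈ Ioo (-1 : ℝ) 1) : 0 < 1 - t ^ 4 := by
  obtain ⟨h₁, h₂⟩ := ht
  have h : t ^ 2 < 1 := by nlinarith
  nlinarith [sq_nonneg t]

lemma continuousOn_lemniscate_integrand :
    ContinuousOn (fun t : ℝ => 1 / Real.sqrt (1 - t ^ 4)) (Ioo (-1) 1) :=
  continuousOn_const.div (by fun_prop) fun _ ht =>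
    (Real.sqrt_pos.2 (one_sub_pow_four_pos ht)).ne'

lemma hasStrictDerivAt_lemniscateA {a : ℝ} (ha : a ∈ Ioo (-1 : ℝ) 1) :
    HasStrictDerivAt lemniscateA (1 / Real.sqrt (1 - a ^ 4)) a := by
  have hsub : uIcc 0 a ⊆ Ioo (-1 : ℝ) 1 :=
    ordConnected_Ioo.uIcc_subset (by norm_num) ha
  exact intervalIntegral.integral_hasStrictDerivAt_right
    (continuousOn_lemniscate_integrand.mono hsub).intervalIntegrable
    (continuousOn_lemniscate_integrand.stronglyMeasurableAtFilter isOpen_Ioo a ha)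
    (continuousOn_lemniscate_integrand.continuousAt (isOpen_Ioo.mem_nhds ha))

lemma continuousOn_lemniscateA : ContinuousOn lemniscateA (Ioo (-1) 1) := fun _ ha =>
  (hasStrictDerivAt_lemniscateA ha).hasDerivAt.continuousAt.continuousWithinAt

lemma strictMonoOn_lemniscateA : StrictMonoOn lemniscateA (Ioo (-1) 1) := by
  refine strictMonoOn_of_deriv_pos (convex_Ioo _ _) continuousOn_lemniscateA fun a ha => ?_
  rw [interior_Ioo] at ha
  rw [(hasStrictDerivAt_lemniscateA ha).hasDerivAt.deriv]
  exact one_div_pos.2 (Real.sqrt_pos.2 (one_sub_pow_four_pos ha))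

lemma lemniscateA_zero : lemniscateA 0 = 0 := by simp [lemniscateA]

/-- The lemniscatic sine, inverting `lemniscateA` on `(-1, 1)`. -/
noncomputable def lemniscateSin : ℝ → ℝ :=
  Function.invFunOn lemniscateA (Ioo (-1) 1)

lemma lemniscateSin_lemniscateA {a : ℝ} (ha : a ∈ Ioo (-1 : ℝ) 1) :
    lemniscateSin (lemniscateA a) = a :=
  strictMonoOn_lemniscateA.injOn.leftInvOn_invFunOn ha

lemma hasDerivAt_lemniscateSin {a : ℝ} (ha : a ∈ Ioo (-1 : ℝ) 1) :
    HasDerivAt lemniscateSin (Real.sqrt (1 - a ^ 4)) (lemniscateA a) := by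
  have h := (hasStrictDerivAt_lemniscateA ha).to_local_left_inverse (g := lemniscateSin)
    (one_div_pos.2 (Real.sqrt_pos.2 (one_sub_pow_four_pos ha))).ne'
    (by filter_upwards [isOpen_Ioo.mem_nhds ha] with b hb using lemniscateSin_lemniscateA hb)
  simpa using h.hasDerivAt

/-- Euler's algebraic addition law for the lemniscatic sine. -/
noncomputable def lemniscateAdd (x y : ℝ) : ℝ :=
  (x * Real.sqrt (1 - y ^ 4) + y * Real.sqrt (1 - x ^ 4)) / (1 + x ^ 2 * y ^ 2)

/-- Euler's law is stationary along a curve solving `u' = √(1 - u⁴)`, `v' = -√(1 - v⁴)`. -/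
lemma hasDerivAt_lemniscateAdd {u v : ℝ → ℝ} {s : ℝ}
    (hu : HasDerivAt u (Real.sqrt (1 - u s ^ 4)) s)
    (hv : HasDerivAt v (-Real.sqrt (1 - v s ^ 4)) s)
    (hus : u s ∈ Ioo (-1 : ℝ) 1) (hvs : v s ∈ Ioo (-1 : ℝ) 1) :
    HasDerivAt (fun r => lemniscateAdd (u r) (v r)) 0 s := by
  have hP := one_sub_pow_four_pos hus
  have hQ := one_sub_pow_four_pos hvs
  have hP' := ((hu.pow 4).const_sub 1).sqrt hP.ne'
  have hQ' := ((hv.pow 4).const_sub 1).sqrt hQ.ne'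
  have hD : (1 : ℝ) + u s ^ 2 * v s ^ 2 ≠ 0 := by positivity
  have h := ((hu.mul hQ').add (hv.mul hP')).div
    (((hu.pow 2).mul (hv.pow 2)).const_add 1) hD
  refine h.congr_deriv ?_
  have hP0 := (Real.sqrt_pos.2 hP).ne'
  have hQ0 := (Real.sqrt_pos.2 hQ).ne'
  have hP2 := Real.sq_sqrt hP.le
  have hQ2 := Real.sq_sqrt hQ.le
  simp only [Pi.pow_apply, Pi.mul_apply, Pi.add_apply]
  generalize Real.sqrt (1 - u s ^ 4) = P at *
  generalize Real.sqrt (1 - v s ^ 4) = Q at *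
  generalize u s = a at *
  generalize v s = b at *
  rw [div_eq_zero_iff]
  left
  field_simp
  push_cast
  linear_combination -4 * a * b ^ 3 * hP2 + 4 * a ^ 3 * b * hQ2

/-- Euler's addition theorem for lemniscatic integrals: if `x, y ∈ [0,1)` and
`A(x) + A(y) < A₁` (the quarter-period, i.e. the supremum of `A` over `[0,1)`), then
`z = (x√(1-y⁴) + y√(1-x⁴)) / (1 + x²y²)` lies in `[0,1)` and `A(x) + A(y) = A(z)`. -/
theorem lemniscate_addition (x y : ℝ) (hx : x ∈ Set.Ico (0 : ℝ) 1)
    (hy : y ∈ Set.Ico (0 : ℝ) 1)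
    (hsum : lemniscateA x + lemniscateA y < sSup (lemniscateA '' Set.Ico (0 : ℝ) 1)) :
    (x * Real.sqrt (1 - y ^ 4) + y * Real.sqrt (1 - x ^ 4)) / (1 + x ^ 2 * y ^ 2) ∈
        Set.Ico (0 : ℝ) 1 ∧
      lemniscateA x + lemniscateA y =
        lemniscateA
          ((x * Real.sqrt (1 - y ^ 4) + y * Real.sqrt (1 - x ^ 4)) / (1 + x ^ 2 * y ^ 2)) := by
  have hIco : Ico (0 : ℝ) 1 ⊆ Ioo (-1) 1 := fun t ht => ⟨by linarith [ht.1], ht.2⟩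
  have hnonneg : ∀ t ∈ Ico (0 : ℝ) 1, 0 ≤ lemniscateA t := fun t ht =>
    lemniscateA_zero ▸ strictMonoOn_lemniscateA.monotoneOn (by norm_num) (hIco ht) ht.1
  have hAx := hnonneg x hx
  have hAy := hnonneg y hy
  obtain ⟨_, ⟨w, hw, rfl⟩, hlt⟩ := exists_lt_of_lt_csSup ⟨_, mem_image_of_mem _ hx⟩ hsum
  have hsurj : ∀ s ∈ Icc 0 (lemniscateA w), ∃ t ∈ Ico (0 : ℝ) 1, lemniscateA t = s := by
    intro s hs
    have hsub : Icc 0 w ⊆ Ico (0 : ℝ) 1 := fun t ht => ⟨ht.1, ht.2.trans_lt hw.2⟩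
    obtain ⟨t, ht, rfl⟩ := intermediate_value_Icc hw.1
      (continuousOn_lemniscateA.mono (hsub.trans hIco)) (by rwa [lemniscateA_zero])
    exact ⟨t, hsub ht, rfl⟩
  obtain ⟨c, hc, hAc⟩ := hsurj _ ⟨add_nonneg hAx hAy, hlt.le⟩
  have hderiv : ∀ s ∈ Icc 0 (lemniscateA c), HasDerivAt
      (fun r => lemniscateAdd (lemniscateSin r) (lemniscateSin (lemniscateA c - r))) 0 s := by
    intro s hs
    obtain ⟨a, ha, hAa⟩ := hsurj s ⟨hs.1, by linarith [hs.2]⟩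
    obtain ⟨b, hb, hAb⟩ := hsurj (lemniscateA c - s) ⟨by linarith [hs.2], by linarith [hs.1]⟩
    have ha' : lemniscateSin s = a := hAa ▸ lemniscateSin_lemniscateA (hIco ha)
    have hb' : lemniscateSin (lemniscateA c - s) = b :=
      hAb ▸ lemniscateSin_lemniscateA (hIco hb)
    have hdu := hasDerivAt_lemniscateSin (hIco ha)
    have hdv := hasDerivAt_lemniscateSin (hIco hb)
    rw [hAa] at hdu
    rw [hAb] at hdv
    refine hasDerivAt_lemniscateAdd (v := fun r => lemniscateSin (lemniscateA c - r)) ?_ ?_ ?_ ?_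
    · rwa [ha']
    · simpa only [hb'] using hdv.comp_const_sub (lemniscateA c) s
    · rw [ha']; exact hIco ha
    · simp only [hb']; exact hIco hb
  have hconst := constant_of_has_deriv_right_zero
    (fun s hs => (hderiv s hs).continuousAt.continuousWithinAt)
    (fun s hs => (hderiv s (Ico_subset_Icc_self hs)).hasDerivWithinAt)
    (lemniscateA x) ⟨hAx, by linarith⟩
  have hsin0 : lemniscateSin 0 = 0 := by
    simpa only [lemniscateA_zero] using lemniscateSin_lemniscateA (a := 0) (by norm_num)
  have hsub : lemniscateA c - lemniscateA x = lemniscateA y := by linarith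
  simp only [hsub, sub_zero, hsin0, lemniscateSin_lemniscateA (hIco hx),
    lemniscateSin_lemniscateA (hIco hy), lemniscateSin_lemniscateA (hIco hc)] at hconst
  have hz : lemniscateAdd x y = c := by rw [hconst]; simp [lemniscateAdd]
  rw [lemniscateAdd] at hz
  rw [hz]
  exact ⟨hc, hAc.symm⟩
end

section
/- Gauss's summation theorem: let α, β, γ ∈ ℂ be such that none of γ, γ−α, γ−β is a nonpositive integer and Re(γ − α − β) > 0. Then the series ∑_{n=0}^∞ (α)_n(β)_n/((γ)_n · n!) converges (HasSum) with sum Γ(γ)·Γ(γ−α−β) / (Γ(γ−α)·Γ(γ−β)), where Γ is the complex Gamma function. -/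
open Filter Topology Asymptotics Finset

/-- The coefficient of `x ^ n` in the hypergeometric series with parameters `α`, `β`, `γ`. -/
noncomputable def hypergeometricCoeff (α β γ : ℂ) (n : ℕ) : ℂ :=
  (ascPochhammer ℂ n).eval α * (ascPochhammer ℂ n).eval β /
    ((ascPochhammer ℂ n).eval γ * (Nat.factorial n : ℂ))

/-- The closed form for the sum of the hypergeometric series at `1`. -/
noncomputable def gaussQuotient (α β γ : ℂ) : ℂ :=
  Complex.Gamma γ * Complex.Gamma (γ - α - β) /
    (Complex.Gamma (γ - α) * Complex.Gamma (γ - β))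

theorem ascPochhammer_eval_eq_prod_range_add (s : ℂ) (n : ℕ) :
    (ascPochhammer ℂ n).eval s = ∏ j ∈ range n, (s + j) := by
  induction n with
  | zero => simp
  | succ n ih => rw [ascPochhammer_succ_eval, prod_range_succ, ih]

theorem ascPochhammer_eval_ne_zero {s : ℂ} (hs : ∀ n : ℕ, s ≠ -(n : ℂ)) (n : ℕ) :
    (ascPochhammer ℂ n).eval s ≠ 0 := by
  rw [Ne, ascPochhammer_eval_eq_zero_iff]
  rintro ⟨k, -, hk⟩
  exact hs k (by rw [hk, neg_neg])

theorem ascPochhammer_eval_succ_eq_div_GammaSeq (s : ℂ) {n : ℕ} (hn : n ≠ 0) :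
    (ascPochhammer ℂ (n + 1)).eval s =
      (Complex.GammaSeq s n)⁻¹ * ((n : ℂ) ^ s * (Nat.factorial n : ℂ)) := by
  have h1 : (n : ℂ) ^ s ≠ 0 := by simp [Complex.cpow_eq_zero_iff, hn]
  have h2 : (Nat.factorial n : ℂ) ≠ 0 := by exact_mod_cast Nat.factorial_ne_zero n
  rw [ascPochhammer_eval_eq_prod_range_add, Complex.GammaSeq, inv_div,
    div_mul_cancel₀ _ (mul_ne_zero h1 h2)]

theorem inv_GammaSeq_isBigO_one (s : ℂ) :
    (fun n : ℕ => (Complex.GammaSeq s n)⁻¹) =O[atTop] (fun _ => (1 : ℝ)) := by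
  by_cases hs : ∀ m : ℕ, s ≠ -(m : ℂ)
  · exact ((Complex.GammaSeq_tendsto_Gamma s).inv₀ (Complex.Gamma_ne_zero hs)).isBigO_one ℝ
  · push Not at hs
    obtain ⟨m, rfl⟩ := hs
    refine EventuallyEq.trans_isBigO ?_ (isBigO_zero _ _)
    filter_upwards [eventually_ge_atTop m] with n hn
    rw [Complex.GammaSeq, ← ascPochhammer_eval_eq_prod_range_add,
      ascPochhammer_eval_neg_coe_nat_of_lt (by lia), div_zero, inv_zero]

theorem succ_mul_hypergeometricCoeff_succ_isBigO (α β γ : ℂ) :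
    (fun n : ℕ => ((n + 1 : ℕ) : ℂ) * hypergeometricCoeff α β γ (n + 1)) =O[atTop]
      (fun n : ℕ => (n : ℝ) ^ (-(γ - α - β).re)) := by
  have hbdd := (((inv_GammaSeq_isBigO_one α).mul (inv_GammaSeq_isBigO_one β)).mul
    ((Complex.GammaSeq_tendsto_Gamma γ).isBigO_one ℝ)).mul
      (isBigO_refl (fun n : ℕ => (n : ℂ) ^ (-(γ - α - β))) atTop).norm_right
  refine EventuallyEq.trans_isBigO ?_ (hbdd.trans (IsBigO.of_bound 1 ?_))
  · filter_upwards [eventually_ne_atTop 0] with n hn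
    have hn' : (n : ℂ) ≠ 0 := by exact_mod_cast hn
    have h1 : (Nat.factorial n : ℂ) ≠ 0 := by exact_mod_cast Nat.factorial_ne_zero n
    have h2 : (n : ℂ) + 1 ≠ 0 := by exact_mod_cast n.succ_ne_zero
    have h3 : (n : ℂ) ^ γ ≠ 0 := by simp [Complex.cpow_eq_zero_iff, hn]
    have h4 : (n : ℂ) ^ (-(γ - α - β)) = (n : ℂ) ^ α * (n : ℂ) ^ β / (n : ℂ) ^ γ := by
      rw [← Complex.cpow_add _ _ hn', ← Complex.cpow_sub _ _ hn']
      ring_nf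
    rw [hypergeometricCoeff, ascPochhammer_eval_succ_eq_div_GammaSeq α hn,
      ascPochhammer_eval_succ_eq_div_GammaSeq β hn, ascPochhammer_eval_succ_eq_div_GammaSeq γ hn,
      h4, Nat.factorial_succ]
    push_cast
    field_simp
  · filter_upwards [eventually_gt_atTop 0] with n hn
    simp [Complex.norm_natCast_cpow_of_pos hn]

theorem tendsto_natCast_mul_hypergeometricCoeff {α β γ : ℂ} (hre : 0 < (γ - α - β).re) :
    Tendsto (fun n : ℕ => (n : ℂ) * hypergeometricCoeff α β γ n) atTop (𝓝 0) := by
  rw [← tendsto_add_atTop_iff_nat 1]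
  exact (succ_mul_hypergeometricCoeff_succ_isBigO α β γ).trans_tendsto
    ((tendsto_rpow_neg_atTop hre).comp tendsto_natCast_atTop_atTop)

theorem summable_hypergeometricCoeff {α β γ : ℂ} (hre : 0 < (γ - α - β).re) :
    Summable (hypergeometricCoeff α β γ) := by
  rw [← summable_nat_add_iff 1]
  refine summable_of_isBigO_nat
    (Real.summable_nat_rpow.mpr (show -(γ - α - β).re - 1 < -1 by linarith)) ?_
  have hinv : (fun n : ℕ => (((n + 1 : ℕ) : ℂ))⁻¹) =O[atTop] (fun n : ℕ => ((n : ℝ))⁻¹) := by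
    refine IsBigO.of_bound 1 ?_
    filter_upwards [eventually_gt_atTop 0] with n hn
    rw [norm_inv, norm_inv, Complex.norm_natCast, Real.norm_natCast, one_mul]
    gcongr
    lia
  refine EventuallyEq.trans_isBigO (Eventually.of_forall fun n => ?_)
    (((succ_mul_hypergeometricCoeff_succ_isBigO α β γ).mul hinv).trans_eventuallyEq ?_)
  · have h2 : ((n + 1 : ℕ) : ℂ) ≠ 0 := by exact_mod_cast n.succ_ne_zero
    field_simp
  · filter_upwards [eventually_gt_atTop 0] with n hn
    rw [Real.rpow_sub_one (by positivity), div_eq_mul_inv]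

theorem ascPochhammer_eval_add_one_mul (s : ℂ) (n : ℕ) :
    s * (ascPochhammer ℂ n).eval (s + 1) = (ascPochhammer ℂ n).eval s * (s + n) := by
  rw [← ascPochhammer_succ_eval, ascPochhammer_succ_left]
  simp

theorem hypergeometricCoeff_contiguous (α β : ℂ) {γ : ℂ} (hγ : ∀ n : ℕ, γ ≠ -(n : ℂ)) (n : ℕ) :
    γ * (γ - α - β) * hypergeometricCoeff α β γ n -
        (γ - α) * (γ - β) * hypergeometricCoeff α β (γ + 1) n =
      γ * (n * hypergeometricCoeff α β γ n -
        (n + 1 : ℕ) * hypergeometricCoeff α β γ (n + 1)) := by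
  have h0 : γ ≠ 0 := by simpa using hγ 0
  have hn : γ + n ≠ 0 := fun h => hγ n (eq_neg_of_add_eq_zero_left h)
  have h1 : (Nat.factorial n : ℂ) ≠ 0 := by exact_mod_cast Nat.factorial_ne_zero n
  have h2 : (n : ℂ) + 1 ≠ 0 := by exact_mod_cast n.succ_ne_zero
  have h3 := ascPochhammer_eval_ne_zero hγ n
  have h4 : (ascPochhammer ℂ n).eval (γ + 1) = (ascPochhammer ℂ n).eval γ * (γ + n) / γ := by
    rw [eq_div_iff h0, mul_comm, ascPochhammer_eval_add_one_mul]
  simp only [hypergeometricCoeff, h4, ascPochhammer_succ_eval, Nat.factorial_succ]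
  push_cast
  field_simp
  ring

theorem tsum_hypergeometricCoeff_contiguous {α β γ : ℂ} (hγ : ∀ n : ℕ, γ ≠ -(n : ℂ))
    (hre : 0 < (γ - α - β).re) :
    γ * (γ - α - β) * ∑' n, hypergeometricCoeff α β γ n =
      (γ - α) * (γ - β) * ∑' n, hypergeometricCoeff α β (γ + 1) n := by
  have hre' : 0 < (γ + 1 - α - β).re := by
    simp only [Complex.sub_re, Complex.add_re, Complex.one_re] at hre ⊢
    linarith
  have hsum := ((summable_hypergeometricCoeff hre).hasSum.mul_left (γ * (γ - α - β))).sub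
    ((summable_hypergeometricCoeff hre').hasSum.mul_left ((γ - α) * (γ - β)))
  have hlim := ((tendsto_natCast_mul_hypergeometricCoeff hre).const_mul γ).neg
  refine sub_eq_zero.mp (tendsto_nhds_unique hsum.tendsto_sum_nat ?_)
  convert hlim using 2 with N
  · rw [sum_congr rfl fun n _ => hypergeometricCoeff_contiguous α β hγ n, ← mul_sum,
      sum_range_sub' (fun n : ℕ => (n : ℂ) * hypergeometricCoeff α β γ n)]
    simp
  · simp

theorem ne_neg_natCast_of_re_pos {s : ℂ} (hs : 0 < s.re) (n : ℕ) : s ≠ -(n : ℂ) := by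
  rintro rfl
  simp only [Complex.neg_re, Complex.natCast_re] at hs
  linarith [n.cast_nonneg (α := ℝ)]

theorem add_natCast_ne_neg_natCast {s : ℂ} (hs : ∀ n : ℕ, s ≠ -(n : ℂ)) (N n : ℕ) :
    s + N ≠ -(n : ℂ) := fun h => hs (N + n) <| by
  push_cast
  linear_combination h

theorem gaussQuotient_contiguous {α β γ : ℂ} (hγ : ∀ n : ℕ, γ ≠ -(n : ℂ))
    (hγα : ∀ n : ℕ, γ - α ≠ -(n : ℂ)) (hγβ : ∀ n : ℕ, γ - β ≠ -(n : ℂ))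
    (hre : 0 < (γ - α - β).re) :
    γ * (γ - α - β) * gaussQuotient α β γ = (γ - α) * (γ - β) * gaussQuotient α β (γ + 1) := by
  have h0 : γ ≠ 0 := by simpa using hγ 0
  have h1 : γ - α ≠ 0 := by simpa using hγα 0
  have h2 : γ - β ≠ 0 := by simpa using hγβ 0
  have h3 : γ - α - β ≠ 0 := by simpa using ne_neg_natCast_of_re_pos hre 0
  have h4 := Complex.Gamma_ne_zero hγα
  have h5 := Complex.Gamma_ne_zero hγβ
  rw [gaussQuotient, gaussQuotient, show γ + 1 - α - β = γ - α - β + 1 by ring,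
    show γ + 1 - α = γ - α + 1 by ring, show γ + 1 - β = γ - β + 1 by ring,
    Complex.Gamma_add_one _ h0, Complex.Gamma_add_one _ h1, Complex.Gamma_add_one _ h2,
    Complex.Gamma_add_one _ h3]
  field_simp

theorem tsum_mul_gaussQuotient_add_natCast {α β γ : ℂ} (hγ : ∀ n : ℕ, γ ≠ -(n : ℂ))
    (hγα : ∀ n : ℕ, γ - α ≠ -(n : ℂ)) (hγβ : ∀ n : ℕ, γ - β ≠ -(n : ℂ))
    (hre : 0 < (γ - α - β).re) (N : ℕ) :
    (∑' n, hypergeometricCoeff α β γ n) * gaussQuotient α β (γ + N) =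
      gaussQuotient α β γ * ∑' n, hypergeometricCoeff α β (γ + N) n := by
  induction N with
  | zero => simp [mul_comm]
  | succ N ih =>
    have hγ' := add_natCast_ne_neg_natCast hγ N
    have hα' : ∀ n : ℕ, γ + N - α ≠ -(n : ℂ) := by
      rw [show γ + N - α = γ - α + N by ring]
      exact add_natCast_ne_neg_natCast hγα N
    have hβ' : ∀ n : ℕ, γ + N - β ≠ -(n : ℂ) := by
      rw [show γ + N - β = γ - β + N by ring]
      exact add_natCast_ne_neg_natCast hγβ N
    have hre' : 0 < (γ + N - α - β).re := by
      simp only [Complex.sub_re, Complex.add_re, Complex.natCast_re] at hre ⊢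
      linarith [N.cast_nonneg (α := ℝ)]
    have hα0 : γ + N - α ≠ 0 := by simpa using hα' 0
    have hβ0 : γ + N - β ≠ 0 := by simpa using hβ' 0
    have hF := tsum_hypergeometricCoeff_contiguous hγ' hre'
    have hG := gaussQuotient_contiguous hγ' hα' hβ' hre'
    rw [Nat.cast_succ, ← add_assoc]
    refine mul_left_cancel₀ (mul_ne_zero hα0 hβ0) ?_
    linear_combination (γ + N) * (γ + N - α - β) * ih + gaussQuotient α β γ * hF
      - (∑' n, hypergeometricCoeff α β γ n) * hG

theorem Gamma_add_natCast {s : ℂ} (hs : ∀ n : ℕ, s ≠ -(n : ℂ)) (n : ℕ) :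
    Complex.Gamma (s + n) = Complex.Gamma s * (ascPochhammer ℂ n).eval s := by
  rw [← Complex.Gamma_add_nat_div_Gamma_eq s hs, mul_div_cancel₀ _ (Complex.Gamma_ne_zero hs)]

theorem tendsto_gaussQuotient_add_natCast {α β γ : ℂ} (hγ : ∀ n : ℕ, γ ≠ -(n : ℂ))
    (hγα : ∀ n : ℕ, γ - α ≠ -(n : ℂ)) (hγβ : ∀ n : ℕ, γ - β ≠ -(n : ℂ))
    (hre : 0 < (γ - α - β).re) :
    Tendsto (fun N : ℕ => gaussQuotient α β (γ + N)) atTop (𝓝 1) := by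
  have hδ := ne_neg_natCast_of_re_pos hre
  have g0 := Complex.Gamma_ne_zero hγ
  have g1 := Complex.Gamma_ne_zero hγα
  have g2 := Complex.Gamma_ne_zero hγβ
  have g3 := Complex.Gamma_ne_zero hδ
  have hlim := (((Complex.GammaSeq_tendsto_Gamma (γ - α)).mul
    (Complex.GammaSeq_tendsto_Gamma (γ - β))).div
    ((Complex.GammaSeq_tendsto_Gamma γ).mul (Complex.GammaSeq_tendsto_Gamma (γ - α - β)))
    (mul_ne_zero g0 g3)).const_mul (gaussQuotient α β γ)
  rw [← tendsto_add_atTop_iff_nat 1]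
  convert hlim.congr' ?_ using 2
  · rw [gaussQuotient]
    field_simp
  · filter_upwards [eventually_ne_atTop 0] with n hn
    have hn' : (n : ℂ) ≠ 0 := by exact_mod_cast hn
    have h1 : (Nat.factorial n : ℂ) ≠ 0 := by exact_mod_cast Nat.factorial_ne_zero n
    have hpow (s : ℂ) : (n : ℂ) ^ s ≠ 0 := by simp [Complex.cpow_eq_zero_iff, hn]
    have hsplit : (n : ℂ) ^ γ * (n : ℂ) ^ (γ - α - β) =
        (n : ℂ) ^ (γ - α) * (n : ℂ) ^ (γ - β) := by
      rw [← Complex.cpow_add _ _ hn', ← Complex.cpow_add _ _ hn']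
      ring_nf
    have hquot : (ascPochhammer ℂ (n + 1)).eval γ * (ascPochhammer ℂ (n + 1)).eval (γ - α - β) /
        ((ascPochhammer ℂ (n + 1)).eval (γ - α) * (ascPochhammer ℂ (n + 1)).eval (γ - β)) =
        Complex.GammaSeq (γ - α) n * Complex.GammaSeq (γ - β) n /
          (Complex.GammaSeq γ n * Complex.GammaSeq (γ - α - β) n) := by
      have hfactor (a b c d x : ℂ) :
          a⁻¹ * (c * x) * (b⁻¹ * (d * x)) = (a * b)⁻¹ * (c * d * (x * x)) := by
        rw [mul_inv]
        ring
      simp only [ascPochhammer_eval_succ_eq_div_GammaSeq _ hn]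
      rw [hfactor, hfactor, hsplit,
        mul_div_mul_right _ _ (mul_ne_zero (mul_ne_zero (hpow _) (hpow _)) (mul_ne_zero h1 h1)),
        inv_div_inv]
    dsimp only [Pi.mul_apply, Pi.div_apply]
    rw [← hquot, gaussQuotient, gaussQuotient,
      show γ + (n + 1 : ℕ) - α - β = γ - α - β + (n + 1 : ℕ) by ring,
      show γ + (n + 1 : ℕ) - α = γ - α + (n + 1 : ℕ) by ring,
      show γ + (n + 1 : ℕ) - β = γ - β + (n + 1 : ℕ) by ring,
      Gamma_add_natCast hγ, Gamma_add_natCast hγα, Gamma_add_natCast hγβ, Gamma_add_natCast hδ]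
    rw [div_mul_div_comm]
    ring

theorem norm_ascPochhammer_eval_le_of_re_le {s t : ℂ} (hs : 0 ≤ s.re) (hst : s.re ≤ t.re)
    (him : s.im = t.im) (n : ℕ) :
    ‖(ascPochhammer ℂ n).eval s‖ ≤ ‖(ascPochhammer ℂ n).eval t‖ := by
  simp only [ascPochhammer_eval_eq_prod_range_add, norm_prod]
  refine prod_le_prod (fun _ _ => norm_nonneg _) fun k _ => ?_
  have hk : (0 : ℝ) ≤ k := k.cast_nonneg
  rw [Complex.norm_def, Complex.norm_def]
  refine Real.sqrt_le_sqrt ?_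
  simp only [Complex.normSq_apply, Complex.add_re, Complex.add_im, Complex.natCast_re,
    Complex.natCast_im, him]
  nlinarith

theorem tendsto_norm_add_natCast_atTop (s : ℂ) :
    Tendsto (fun N : ℕ => ‖s + N‖) atTop atTop := by
  refine tendsto_atTop_mono (fun N => Complex.re_le_norm (s + N)) ?_
  simpa using tendsto_atTop_add_const_left atTop s.re (tendsto_natCast_atTop_atTop (R := ℝ))

theorem tendsto_hypergeometricCoeff_add_natCast (α β γ : ℂ) (n : ℕ) :
    Tendsto (fun N : ℕ => hypergeometricCoeff α β (γ + N) n) atTop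
      (𝓝 (if n = 0 then 1 else 0)) := by
  rcases eq_or_ne n 0 with rfl | hn
  · simp [hypergeometricCoeff]
  · have hdeg : 0 < (ascPochhammer ℂ n).degree := by
      rw [← Polynomial.natDegree_pos_iff_degree_pos, ascPochhammer_natDegree]
      exact Nat.pos_of_ne_zero hn
    have hinv := tendsto_inv₀_cobounded.comp <| tendsto_norm_atTop_iff_cobounded.mp <|
      (ascPochhammer ℂ n).tendsto_norm_atTop hdeg (tendsto_norm_add_natCast_atTop γ)
    have hlim := hinv.const_mul
      ((ascPochhammer ℂ n).eval α * (ascPochhammer ℂ n).eval β / (Nat.factorial n : ℂ))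
    rw [mul_zero] at hlim
    rw [if_neg hn]
    refine hlim.congr fun N => ?_
    rw [hypergeometricCoeff, Function.comp_apply, ← div_eq_mul_inv, div_div, mul_comm]
    ring

theorem tendsto_tsum_hypergeometricCoeff_add_natCast {α β γ : ℂ} (hre : 0 < (γ - α - β).re) :
    Tendsto (fun N : ℕ => ∑' n, hypergeometricCoeff α β (γ + N) n) atTop (𝓝 1) := by
  obtain ⟨M, hM⟩ := exists_nat_gt (-γ.re)
  have hMre : 0 < (γ + M).re := by
    simp only [Complex.add_re, Complex.natCast_re]
    linarith
  have hre' : 0 < (γ + M - α - β).re := by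
    simp only [Complex.sub_re, Complex.add_re, Complex.natCast_re] at hre ⊢
    linarith [M.cast_nonneg (α := ℝ)]
  have hlim := tendsto_tsum_of_dominated_convergence (summable_hypergeometricCoeff hre').norm
    (tendsto_hypergeometricCoeff_add_natCast α β γ) ?_
  · simpa using hlim
  · filter_upwards [eventually_ge_atTop M] with N hN n
    have hpos := norm_pos_iff.mpr (ascPochhammer_eval_ne_zero (ne_neg_natCast_of_re_pos hMre) n)
    have hle := norm_ascPochhammer_eval_le_of_re_le (s := γ + M) (t := γ + N) hMre.le
      (by simpa using hN) (by simp) n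
    have hfac : 0 < ‖(Nat.factorial n : ℂ)‖ := by
      simpa using Nat.factorial_pos n
    simp only [hypergeometricCoeff, norm_div, norm_mul]
    gcongr

/-- Gauss's summation theorem: if none of `γ`, `γ-α`, `γ-β` is a nonpositive integer and
`Re(γ - α - β) > 0`, then `∑ (α)ₙ(β)ₙ/((γ)ₙ n!) = Γ(γ)Γ(γ-α-β)/(Γ(γ-α)Γ(γ-β))`. -/
theorem gauss_summation (α β γ : ℂ)
    (hγ : ∀ n : ℕ, γ ≠ -(n : ℂ)) (hγα : ∀ n : ℕ, γ - α ≠ -(n : ℂ))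
    (hγβ : ∀ n : ℕ, γ - β ≠ -(n : ℂ)) (hre : 0 < (γ - α - β).re) :
    HasSum
      (fun n : ℕ =>
        (ascPochhammer ℂ n).eval α * (ascPochhammer ℂ n).eval β /
          ((ascPochhammer ℂ n).eval γ * (Nat.factorial n : ℂ)))
      (Complex.Gamma γ * Complex.Gamma (γ - α - β) /
        (Complex.Gamma (γ - α) * Complex.Gamma (γ - β))) := by
  have hF := summable_hypergeometricCoeff hre
  have hleft := (tendsto_gaussQuotient_add_natCast hγ hγα hγβ hre).const_mul
    (∑' n, hypergeometricCoeff α β γ n)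
  have hright := (tendsto_tsum_hypergeometricCoeff_add_natCast hre).const_mul
    (gaussQuotient α β γ)
  have heq := tendsto_nhds_unique hleft
    (hright.congr fun N => (tsum_mul_gaussQuotient_add_natCast hγ hγα hγβ hre N).symm)
  rw [mul_one, mul_one] at heq
  have hsum := hF.hasSum
  rwa [heq] at hsum
end

section
/- Dirichlet's convergence theorem for Fourier series (bounded variation form): let f : ℝ → ℂ be 2π-periodic and of bounded variation on [0, 2π], let x ∈ ℝ, and suppose f(t) → L⁺ as t → x from the right and f(t) → L⁻ as t → x from the left. Then the symmetric partial sums S_N f(x) converge, as N → ∞, to (L⁺ + L⁻)/2. -/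
open scoped Real
open MeasureTheory Set Filter Topology

/-- Integrating a function over a superlevel set of a monotone function within `[a, b]` is
integrating it over an interval `[c, b]`. -/
lemma exists_integral_superlevel_eq {a b : ℝ} (hab : a ≤ b) {p : ℝ → ℝ} (hp : Monotone p)
    (φ : ℝ → ℝ) (s : ℝ) :
    ∃ c ∈ Icc a b, ∫ t in Ioc a b, {t | s < p t}.indicator φ t = ∫ t in c..b, φ t := by
  set S : Set ℝ := insert b {t | t ∈ Icc a b ∧ s < p t} with hS
  have hlb : ∀ t ∈ S, a ≤ t := by
    rintro t (rfl | ht)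
    · exact hab
    · exact ht.1.1
  have hbS : b ∈ S := mem_insert _ _
  have hbdd : BddBelow S := ⟨a, hlb⟩
  have hcb : sInf S ≤ b := csInf_le hbdd hbS
  have hac : a ≤ sInf S := le_csInf ⟨b, hbS⟩ hlb
  refine ⟨sInf S, ⟨hac, hcb⟩, ?_⟩
  rw [intervalIntegral.integral_of_le hcb, ← integral_indicator measurableSet_Ioc,
    ← integral_indicator measurableSet_Ioc]
  apply integral_congr_ae
  filter_upwards [Measure.ae_ne volume b, Measure.ae_ne volume (sInf S)] with t htb htc
  by_cases h : t ∈ Ioc (sInf S) b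
  · have hlt : t < b := lt_of_le_of_ne h.2 htb
    obtain ⟨u, huS, hut⟩ := exists_lt_of_csInf_lt ⟨b, hbS⟩ h.1
    have hsu : s < p u := by
      rcases huS with rfl | hu
      · exact absurd hut hlt.not_gt
      · exact hu.2
    have hst : t ∈ {t | s < p t} := hsu.trans_le (hp hut.le)
    rw [indicator_of_mem h,
      indicator_of_mem (show t ∈ Ioc a b from ⟨hac.trans_lt h.1, h.2⟩), indicator_of_mem hst]
  · rw [indicator_of_notMem h]
    by_cases h' : t ∈ Ioc a b
    · rw [indicator_of_mem h']
      apply indicator_of_notMem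
      intro hst
      have : sInf S ≤ t := csInf_le hbdd (Or.inr ⟨⟨h'.1.le, h'.2⟩, hst⟩)
      exact h ⟨lt_of_le_of_ne this htc.symm, h'.2⟩
    · exact indicator_of_notMem h' _

/-- Bonnet's form of the second mean value theorem, as an inequality. -/
lemma Monotone.abs_integral_mul_le {a b : ℝ} (hab : a ≤ b) {p φ : ℝ → ℝ} (hp : Monotone p)
    (hp0 : ∀ t, 0 ≤ p t) (hφ : Continuous φ) {M : ℝ}
    (hM : ∀ c ∈ Icc a b, |∫ t in c..b, φ t| ≤ M) :
    |∫ t in a..b, p t * φ t| ≤ M * p b := by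
  have layer : ∀ t ∈ Ioc a b,
      p t * φ t = ∫ s in Ioc 0 (p b), {t | s < p t}.indicator φ t := by
    intro t ht
    have h1 : ∀ s, {t | s < p t}.indicator φ t = (Iio (p t)).indicator (fun _ => φ t) s := by
      intro s
      by_cases hs : s < p t
      · rw [indicator_of_mem (show t ∈ {t | s < p t} from hs),
          indicator_of_mem (show s ∈ Iio (p t) from hs)]
      · rw [indicator_of_notMem (show t ∉ {t | s < p t} from hs),
          indicator_of_notMem (show s ∉ Iio (p t) from hs)]
    simp_rw [h1]
    rw [setIntegral_indicator measurableSet_Iio, setIntegral_const]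
    have h2 : Ioc 0 (p b) ∩ Iio (p t) = Ioo 0 (p t) := by
      ext s
      have := hp ht.2
      simp only [mem_inter_iff, mem_Ioc, mem_Iio, mem_Ioo]
      constructor
      · rintro ⟨⟨h, -⟩, h'⟩; exact ⟨h, h'⟩
      · rintro ⟨h, h'⟩; exact ⟨⟨h, h'.le.trans this⟩, h'⟩
    rw [h2, Real.volume_real_Ioo_of_le (hp0 t), sub_zero, smul_eq_mul]
  have hint : Integrable (Function.uncurry fun t s => {t | s < p t}.indicator φ t)
      ((volume.restrict (Ioc a b)).prod (volume.restrict (Ioc 0 (p b)))) := by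
    have hφi : Integrable φ (volume.restrict (Ioc a b)) := hφ.integrableOn_Ioc
    have := (hφi.comp_fst (volume.restrict (Ioc 0 (p b)))).indicator
      (measurableSet_lt measurable_snd (hp.measurable.comp measurable_fst))
    exact this
  rw [intervalIntegral.integral_of_le hab, setIntegral_congr_fun measurableSet_Ioc layer,
    integral_integral_swap hint]
  have := norm_setIntegral_le_of_norm_le_const (μ := volume) (s := Ioc 0 (p b)) (C := M)
    (f := fun s => ∫ t in Ioc a b, {t | s < p t}.indicator φ t) measure_Ioc_lt_top
    (fun s _ => by
      obtain ⟨c, hc, h⟩ := exists_integral_superlevel_eq hab hp φ s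
      rw [h]
      exact hM c hc)
  rwa [Real.volume_real_Ioc_of_le (hp0 b), sub_zero] at this

/-- The Dirichlet kernel `∑_{|n| ≤ N} e^{inu}`, in real form. -/
noncomputable def dirichletKernel (N : ℕ) (u : ℝ) : ℝ :=
  1 + 2 * ∑ k ∈ Finset.range N, Real.cos ((k + 1) * u)

lemma continuous_dirichletKernel (N : ℕ) : Continuous (dirichletKernel N) := by
  unfold dirichletKernel
  fun_prop

lemma dirichletKernel_succ (N : ℕ) (u : ℝ) :
    dirichletKernel (N + 1) u = dirichletKernel N u + 2 * Real.cos ((N + 1) * u) := by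
  simp only [dirichletKernel, Finset.sum_range_succ]
  ring

lemma dirichletKernel_neg (N : ℕ) (u : ℝ) : dirichletKernel N (-u) = dirichletKernel N u := by
  simp [dirichletKernel]

lemma periodic_dirichletKernel (N : ℕ) : Function.Periodic (dirichletKernel N) (2 * π) := by
  intro u
  unfold dirichletKernel
  congr 2
  refine Finset.sum_congr rfl fun k _ => ?_
  have := Real.cos_add_nat_mul_two_pi (((k : ℝ) + 1) * u) (k + 1)
  rw [← this]
  push_cast
  ring_nf

lemma dirichletKernel_mul_sin (N : ℕ) (u : ℝ) :
    dirichletKernel N u * Real.sin (u / 2) = Real.sin ((N + 1 / 2) * u) := by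
  induction N with
  | zero => simp [dirichletKernel]; ring_nf
  | succ N ih =>
    rw [dirichletKernel_succ, add_mul, ih]
    have h1 : ((N : ℝ) + 1 / 2) * u = (N + 1) * u - u / 2 := by ring
    have h2 : (((N + 1 : ℕ) : ℝ) + 1 / 2) * u = (N + 1) * u + u / 2 := by push_cast; ring
    rw [h1, h2, Real.sin_sub, Real.sin_add]
    ring

lemma abs_dirichletKernel_le (N : ℕ) (u : ℝ) : |dirichletKernel N u| ≤ 2 * (N + 1 / 2) := by
  induction N with
  | zero => simp [dirichletKernel]
  | succ N ih =>
    rw [dirichletKernel_succ]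
    have := abs_add_le (dirichletKernel N u) (2 * Real.cos ((N + 1) * u))
    have h : |2 * Real.cos (((N : ℝ) + 1) * u)| ≤ 2 := by
      rw [abs_mul, abs_two]
      linarith [Real.abs_cos_le_one (((N : ℝ) + 1) * u)]
    push_cast
    linarith

lemma integral_dirichletKernel (N : ℕ) : ∫ u in (0 : ℝ)..π, dirichletKernel N u = π := by
  induction N with
  | zero => simp [dirichletKernel]
  | succ N ih =>
    simp_rw [dirichletKernel_succ]
    rw [intervalIntegral.integral_add ((continuous_dirichletKernel N).intervalIntegrable _ _)
      (by apply Continuous.intervalIntegrable; fun_prop), ih,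
      intervalIntegral.integral_const_mul,
      intervalIntegral.integral_comp_mul_left (fun u => Real.cos u) (by positivity), integral_cos]
    have := Real.sin_nat_mul_pi (N + 1)
    push_cast at this
    simp [this]

lemma sum_exp_eq_dirichletKernel (N : ℕ) (u : ℝ) :
    ∑ n ∈ Finset.Icc (-(N : ℤ)) (N : ℤ), Complex.exp (Complex.I * (n : ℂ) * (u : ℂ)) =
      (dirichletKernel N u : ℂ) := by
  induction N with
  | zero => simp [dirichletKernel]
  | succ N ih =>
    have h : Finset.Icc (-((N + 1 : ℕ) : ℤ)) ((N + 1 : ℕ) : ℤ) =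
        insert (-((N : ℤ) + 1)) (insert ((N : ℤ) + 1) (Finset.Icc (-(N : ℤ)) (N : ℤ))) := by
      ext n
      simp only [Finset.mem_Icc, Finset.mem_insert]
      omega
    rw [h, Finset.sum_insert (by simp only [Finset.mem_Icc, Finset.mem_insert]; omega),
      Finset.sum_insert (by simp only [Finset.mem_Icc]; omega), ih, dirichletKernel_succ]
    push_cast
    rw [Complex.cos]
    ring_nf

lemma abs_integral_sin_mul_le {m : ℝ} (hm : 0 < m) (c d : ℝ) :
    |∫ u in c..d, Real.sin (m * u)| ≤ 2 / m := by
  rw [intervalIntegral.integral_comp_mul_left (fun u => Real.sin u) hm.ne', integral_sin,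
    smul_eq_mul, abs_mul, abs_of_pos (inv_pos.2 hm), div_eq_inv_mul]
  gcongr
  have h1 := abs_le.1 (Real.abs_cos_le_one (m * c))
  have h2 := abs_le.1 (Real.abs_cos_le_one (m * d))
  rw [abs_le]
  constructor <;> linarith

lemma abs_integral_dirichletKernel_le_div (N : ℕ) {c d : ℝ} (hc : 0 < c) (hcd : c ≤ d)
    (hd : d ≤ π) :
    |∫ u in c..d, dirichletKernel N u| ≤ 4 * π / ((N + 1 / 2) * c) := by
  set m : ℝ := N + 1 / 2 with hm
  have hm0 : 0 < m := by positivity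
  have hsin : ∀ u ∈ Icc c d, 0 < Real.sin (u / 2) := fun u hu =>
    Real.sin_pos_of_pos_of_lt_pi (by linarith [hu.1]) (by linarith [hu.2, Real.pi_pos])
  have hmono : MonotoneOn (fun u => (Real.sin (c / 2))⁻¹ - (Real.sin (u / 2))⁻¹) (Icc c d) := by
    intro u hu v hv huv
    have : Real.sin (u / 2) ≤ Real.sin (v / 2) :=
      Real.sin_le_sin_of_le_of_le_pi_div_two (by linarith [hu.1, Real.pi_pos])
        (by linarith [hv.2]) (by linarith)
    have := inv_anti₀ (hsin u hu) this
    dsimp only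
    linarith
  obtain ⟨r, hr, hreq⟩ := hmono.exists_monotone_extension
    (hmono.map_bddBelow Subset.rfl ⟨c, fun x hx => hx.1, ⟨le_rfl, hcd⟩⟩)
    (hmono.map_bddAbove Subset.rfl ⟨d, fun x hx => hx.2, ⟨hcd, le_rfl⟩⟩)
  have hr0 : r c = 0 := by rw [← hreq ⟨le_rfl, hcd⟩]; simp
  have hr' : Monotone fun u => max (r u) 0 := hr.max monotone_const
  have hrd : max (r d) 0 ≤ (Real.sin (c / 2))⁻¹ := by
    rw [← hreq ⟨hcd, le_rfl⟩]
    have := inv_pos.2 (hsin d ⟨hcd, le_rfl⟩)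
    have := inv_pos.2 (hsin c ⟨le_rfl, hcd⟩)
    exact max_le (by dsimp only; linarith) (by linarith)
  have hb := hr'.abs_integral_mul_le hcd (fun _ => le_max_right _ _)
    (φ := fun u => Real.sin (m * u)) (by fun_prop)
    (fun c' _ => abs_integral_sin_mul_le hm0 c' d)
  have hs := abs_integral_sin_mul_le hm0 c d
  have heq : ∫ u in c..d, dirichletKernel N u =
      (Real.sin (c / 2))⁻¹ * (∫ u in c..d, Real.sin (m * u)) -
        ∫ u in c..d, max (r u) 0 * Real.sin (m * u) := by
    rw [← intervalIntegral.integral_const_mul, ← intervalIntegral.integral_sub]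
    · apply intervalIntegral.integral_congr
      intro u hu
      rw [uIcc_of_le hcd] at hu
      have h0 : 0 ≤ r u := hr0 ▸ hr hu.1
      have hne := (hsin u hu).ne'
      dsimp only
      rw [max_eq_left h0, ← hreq hu, hm, ← dirichletKernel_mul_sin]
      field_simp
      ring
    · apply Continuous.intervalIntegrable; fun_prop
    · exact (hr'.monotoneOn _).intervalIntegrable.mul_continuousOn (by fun_prop)
  have hc2 : (Real.sin (c / 2))⁻¹ ≤ π / c := by
    have := Real.mul_le_sin (x := c / 2) (by linarith) (by linarith)
    rw [show π / c = (2 / π * (c / 2))⁻¹ by field_simp]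
    exact inv_anti₀ (by positivity) this
  have hi0 := inv_pos.2 (hsin c ⟨le_rfl, hcd⟩)
  rw [heq]
  calc _ ≤ (Real.sin (c / 2))⁻¹ * (2 / m) + 2 / m * (Real.sin (c / 2))⁻¹ := by
        refine (abs_sub _ _).trans (add_le_add ?_ (hb.trans ?_))
        · rw [abs_mul, abs_of_pos hi0]
          gcongr
        · gcongr
    _ = 4 / m * (Real.sin (c / 2))⁻¹ := by ring
    _ ≤ 4 / m * (π / c) := by gcongr
    _ = _ := by field_simp

lemma abs_integral_dirichletKernel_le (N : ℕ) {c d : ℝ} (hc : 0 ≤ c) (hcd : c ≤ d)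
    (hd : d ≤ π) :
    |∫ u in c..d, dirichletKernel N u| ≤ 2 + 4 * π := by
  have hm0 : (0 : ℝ) < N + 1 / 2 := by positivity
  have hcont := continuous_dirichletKernel N
  have short : ∀ e, c ≤ e → e ≤ c + 1 / (N + 1 / 2) →
      |∫ u in c..e, dirichletKernel N u| ≤ 2 := by
    intro e hce he
    have := intervalIntegral.norm_integral_le_of_norm_le_const (a := c) (b := e)
      (f := dirichletKernel N) (fun u _ => abs_dirichletKernel_le N u)
    refine this.trans ?_
    rw [abs_of_nonneg (by linarith)]
    calc 2 * ((N : ℝ) + 1 / 2) * (e - c) ≤ 2 * (N + 1 / 2) * (1 / (N + 1 / 2)) := by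
          gcongr; linarith
      _ = 2 := by field_simp
  rcases le_total d (c + 1 / (N + 1 / 2)) with h | h
  · linarith [short d hcd h, Real.pi_pos]
  · set e := c + 1 / ((N : ℝ) + 1 / 2) with he
    have hinv : 0 < 1 / ((N : ℝ) + 1 / 2) := by positivity
    rw [← intervalIntegral.integral_add_adjacent_intervals (hcont.intervalIntegrable c e)
      (hcont.intervalIntegrable e d)]
    refine (abs_add_le _ _).trans (add_le_add (short e (by linarith) le_rfl) ?_)
    refine (abs_integral_dirichletKernel_le_div N (by linarith) h hd).trans ?_
    rw [div_le_iff₀ (by positivity)]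
    have : 1 ≤ ((N : ℝ) + 1 / 2) * e := by
      rw [he, mul_add, mul_one_div_cancel hm0.ne']
      have := mul_nonneg hm0.le hc
      linarith
    nlinarith [Real.pi_pos]

/-- A monotone function vanishing at `0⁺` does not charge the Dirichlet kernel in the limit. -/
lemma Monotone.tendsto_integral_mul_dirichletKernel_zero {p : ℝ → ℝ} (hp : Monotone p)
    (hlim : Tendsto p (𝓝[>] 0) (𝓝 0)) :
    Tendsto (fun N : ℕ => ∫ u in (0 : ℝ)..π, p u * dirichletKernel N u) atTop (𝓝 0) := by
  have hpi := Real.pi_pos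
  set q : ℝ → ℝ := fun u => max (p u) 0 with hq
  have hqm : Monotone q := hp.max monotone_const
  have hq0 : ∀ u, 0 ≤ q u := fun u => le_max_right _ _
  have hpos : ∀ u, 0 < u → 0 ≤ p u := fun u hu =>
    _root_.le_of_tendsto hlim (by
      filter_upwards [Ioo_mem_nhdsGT hu] with v hv using hp hv.2.le)
  have hqlim : Tendsto q (𝓝[>] 0) (𝓝 0) := by
    simpa using hlim.max (tendsto_const_nhds (x := (0 : ℝ)))
  have heq : ∀ N, ∫ u in (0 : ℝ)..π, p u * dirichletKernel N u =
      ∫ u in (0 : ℝ)..π, q u * dirichletKernel N u := by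
    intro N
    rw [intervalIntegral.integral_of_le hpi.le, intervalIntegral.integral_of_le hpi.le]
    exact setIntegral_congr_fun measurableSet_Ioc fun u hu => by
      simp only [hq, max_eq_left (hpos u hu.1)]
  simp_rw [heq]
  have hint : ∀ N a b, IntervalIntegrable (fun u => q u * dirichletKernel N u) volume a b :=
    fun N a b => (hqm.monotoneOn _).intervalIntegrable.mul_continuousOn
      (continuous_dirichletKernel N).continuousOn
  rw [Metric.tendsto_atTop]
  intro ε hε
  obtain ⟨δ, hδq, hδ⟩ : ∃ δ, q δ < ε / 2 / (2 + 4 * π) ∧ δ ∈ Ioo 0 π :=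
    ((hqlim.eventually_lt_const (by positivity)).and (Ioo_mem_nhdsGT hpi)).exists
  have htail : Tendsto (fun N : ℕ => 4 * π / (((N : ℝ) + 1 / 2) * δ) * q π) atTop (𝓝 0) := by
    have h1 : Tendsto (fun N : ℕ => ((N : ℝ) + 1 / 2) * δ) atTop atTop :=
      (tendsto_atTop_add_const_right _ _ tendsto_natCast_atTop_atTop).atTop_mul_const hδ.1
    simpa using (h1.const_div_atTop (4 * π)).mul_const (q π)
  obtain ⟨N₀, hN₀⟩ := eventually_atTop.1 (htail.eventually_lt_const (half_pos hε))
  refine ⟨N₀, fun N hN => ?_⟩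
  rw [Real.dist_0_eq_abs, ← intervalIntegral.integral_add_adjacent_intervals (hint N 0 δ)
    (hint N δ π)]
  have hnear := hqm.abs_integral_mul_le hδ.1.le hq0 (continuous_dirichletKernel N)
    (fun c hc => abs_integral_dirichletKernel_le N hc.1 hc.2 hδ.2.le)
  have hfar := hqm.abs_integral_mul_le hδ.2.le hq0 (continuous_dirichletKernel N)
    (M := 4 * π / (((N : ℝ) + 1 / 2) * δ)) (fun c hc =>
      (abs_integral_dirichletKernel_le_div N (hδ.1.trans_le hc.1) hc.2 le_rfl).trans (by
        have := hδ.1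
        have := hc.1
        gcongr))
  have h1 : (2 + 4 * π) * q δ < ε / 2 := by
    rwa [lt_div_iff₀ (by positivity), mul_comm] at hδq
  exact (abs_add_le _ _).trans_lt (by linarith [hN₀ N hN])

lemma Monotone.tendsto_integral_mul_dirichletKernel {p : ℝ → ℝ} (hp : Monotone p) {L : ℝ}
    (hlim : Tendsto p (𝓝[>] 0) (𝓝 L)) :
    Tendsto (fun N : ℕ => ∫ u in (0 : ℝ)..π, p u * dirichletKernel N u) atTop (𝓝 (π * L)) := by
  have h := (hp.add_const (-L)).tendsto_integral_mul_dirichletKernel_zero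
    (by simpa using hlim.add_const (-L))
  have heq : ∀ N, ∫ u in (0 : ℝ)..π, p u * dirichletKernel N u =
      (∫ u in (0 : ℝ)..π, (p u + -L) * dirichletKernel N u) + π * L := by
    intro N
    have hc := continuous_dirichletKernel N
    have h1 : IntervalIntegrable (fun u => p u * dirichletKernel N u) volume 0 π :=
      (hp.monotoneOn _).intervalIntegrable.mul_continuousOn hc.continuousOn
    simp_rw [add_mul]
    rw [intervalIntegral.integral_add h1 ((hc.intervalIntegrable _ _).const_mul _),
      intervalIntegral.integral_const_mul, integral_dirichletKernel]
    ring
  simp_rw [heq]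
  simpa using h.add_const (π * L)

/-- A real function of bounded variation on `[a, b]` agrees there with a difference of two
monotone functions on the line. -/
lemma BoundedVariationOn.exists_monotone_sub_monotone {a b : ℝ} (hab : a ≤ b) {g : ℝ → ℝ}
    (hg : BoundedVariationOn g (Icc a b)) :
    ∃ p q : ℝ → ℝ, Monotone p ∧ Monotone q ∧ EqOn g (p - q) (Icc a b) := by
  have key : ∀ p : ℝ → ℝ, MonotoneOn p (Icc a b) → ∃ p', Monotone p' ∧ EqOn p p' (Icc a b) :=
    fun p hp => hp.exists_monotone_extension
      (hp.map_bddBelow Subset.rfl ⟨a, fun x hx => hx.1, ⟨le_rfl, hab⟩⟩)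
      (hp.map_bddAbove Subset.rfl ⟨b, fun x hx => hx.2, ⟨hab, le_rfl⟩⟩)
  obtain ⟨p, q, hp, hq, rfl⟩ := hg.locallyBoundedVariationOn.exists_monotoneOn_sub_monotoneOn
  obtain ⟨p', hp', hpp⟩ := key p hp
  obtain ⟨q', hq', hqq⟩ := key q hq
  exact ⟨p', q', hp', hq', fun x hx => by simp [hpp hx, hqq hx]⟩

lemma BoundedVariationOn.tendsto_integral_mul_dirichletKernel_real {g : ℝ → ℝ}
    (hg : BoundedVariationOn g (Icc 0 π)) {L : ℝ} (hlim : Tendsto g (𝓝[>] 0) (𝓝 L)) :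
    Tendsto (fun N : ℕ => ∫ u in (0 : ℝ)..π, g u * dirichletKernel N u) atTop (𝓝 (π * L)) := by
  obtain ⟨p, q, hp, hq, hpq⟩ := hg.exists_monotone_sub_monotone Real.pi_pos.le
  have hpl := hp.tendsto_nhdsGT 0
  have hql := hq.tendsto_nhdsGT 0
  have hL : L = sInf (p '' Ioi 0) - sInf (q '' Ioi 0) := by
    refine tendsto_nhds_unique (hlim.congr' ?_) (hpl.sub hql)
    filter_upwards [Ioo_mem_nhdsGT Real.pi_pos] with u hu using hpq ⟨hu.1.le, hu.2.le⟩
  rw [hL, mul_sub]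
  refine ((hp.tendsto_integral_mul_dirichletKernel hpl).sub
    (hq.tendsto_integral_mul_dirichletKernel hql)).congr fun N => ?_
  have hc := (continuous_dirichletKernel N).continuousOn (s := uIcc 0 π)
  rw [← intervalIntegral.integral_sub
    ((hp.monotoneOn _).intervalIntegrable.mul_continuousOn hc)
    ((hq.monotoneOn _).intervalIntegrable.mul_continuousOn hc)]
  refine intervalIntegral.integral_congr fun u hu => ?_
  rw [uIcc_of_le Real.pi_pos.le] at hu
  simp only [hpq hu, Pi.sub_apply]
  ring

lemma IntervalIntegrable.complex_ofReal {a b : ℝ} {g : ℝ → ℝ}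
    (hg : IntervalIntegrable g volume a b) :
    IntervalIntegrable (fun u => (g u : ℂ)) volume a b :=
  ⟨hg.1.ofReal, hg.2.ofReal⟩

lemma BoundedVariationOn.re {s : Set ℝ} {g : ℝ → ℂ} (hg : BoundedVariationOn g s) :
    BoundedVariationOn (fun u => (g u).re) s :=
  Complex.reCLM.lipschitz.comp_boundedVariationOn hg

lemma BoundedVariationOn.im {s : Set ℝ} {g : ℝ → ℂ} (hg : BoundedVariationOn g s) :
    BoundedVariationOn (fun u => (g u).im) s :=
  Complex.imCLM.lipschitz.comp_boundedVariationOn hg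

lemma BoundedVariationOn.intervalIntegrable_real {a b : ℝ} (hab : a ≤ b) {g : ℝ → ℝ}
    (hg : BoundedVariationOn g (Icc a b)) : IntervalIntegrable g volume a b := by
  obtain ⟨p, q, hp, hq, hpq⟩ := hg.exists_monotone_sub_monotone hab
  refine ((hp.monotoneOn _).intervalIntegrable.sub (hq.monotoneOn _).intervalIntegrable).congr ?_
  intro u hu
  rw [uIoc_of_le hab] at hu
  exact (hpq ⟨hu.1.le, hu.2⟩).symm

lemma BoundedVariationOn.intervalIntegrable {a b : ℝ} (hab : a ≤ b) {g : ℝ → ℂ}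
    (hg : BoundedVariationOn g (Icc a b)) : IntervalIntegrable g volume a b := by
  have h := (hg.re.intervalIntegrable_real hab).complex_ofReal.add
    ((hg.im.intervalIntegrable_real hab).complex_ofReal.mul_const Complex.I)
  refine h.congr fun u _ => ?_
  simp

/-- **Dirichlet–Jordan**: one-sided localization of the Dirichlet kernel against a function of
bounded variation. -/
lemma BoundedVariationOn.tendsto_integral_mul_dirichletKernel {g : ℝ → ℂ}
    (hg : BoundedVariationOn g (Icc 0 π)) {L : ℂ} (hlim : Tendsto g (𝓝[>] 0) (𝓝 L)) :
    Tendsto (fun N : ℕ => ∫ u in (0 : ℝ)..π, g u * (dirichletKernel N u : ℂ)) atTop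
      (𝓝 (π * L)) := by
  have hre := hg.re.tendsto_integral_mul_dirichletKernel_real
    ((Complex.continuous_re.tendsto L).comp hlim)
  have him := hg.im.tendsto_integral_mul_dirichletKernel_real
    ((Complex.continuous_im.tendsto L).comp hlim)
  have h := ((Complex.continuous_ofReal.tendsto _).comp hre).add
    (((Complex.continuous_ofReal.tendsto _).comp him).mul_const Complex.I)
  have hL : ((π * L.re : ℝ) : ℂ) + ((π * L.im : ℝ) : ℂ) * Complex.I = π * L := by
    conv_rhs => rw [← Complex.re_add_im L]
    push_cast
    ring
  rw [hL] at h
  refine h.congr fun N => ?_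
  have hc := (continuous_dirichletKernel N).continuousOn (s := uIcc 0 π)
  have h1 := (hg.re.intervalIntegrable_real Real.pi_pos.le).mul_continuousOn hc
  have h2 := (hg.im.intervalIntegrable_real Real.pi_pos.le).mul_continuousOn hc
  simp only [Function.comp_apply]
  rw [← intervalIntegral.integral_ofReal, ← intervalIntegral.integral_ofReal,
    ← intervalIntegral.integral_mul_const, ← intervalIntegral.integral_add h1.complex_ofReal
      (h2.complex_ofReal.mul_const _)]
  refine intervalIntegral.integral_congr fun u _ => ?_
  conv_rhs => rw [← Complex.re_add_im (g u)]
  push_cast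
  ring

/-- A periodic function of bounded variation on one period has bounded variation on every
interval of the length of a period. -/
lemma Function.Periodic.boundedVariationOn_Icc {E : Type*} [PseudoEMetricSpace E] {f : ℝ → E}
    {T : ℝ} (hper : Function.Periodic f T) (hT : 0 < T) (hbv : BoundedVariationOn f (Icc 0 T))
    (a : ℝ) : BoundedVariationOn f (Icc a (a + T)) := by
  have shift : ∀ k : ℤ, BoundedVariationOn f (Icc (k * T) (k * T + T)) := by
    intro k
    have heq : f = f ∘ fun t => t - k * T := by
      funext t
      exact (hper.sub_int_mul_eq k).symm
    rw [heq]
    refine ne_top_of_le_ne_top hbv (eVariationOn.comp_le_of_monotoneOn f _ ?_ ?_)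
    · exact fun u _ v _ huv => sub_le_sub_right huv _
    · intro u hu
      exact ⟨by linarith [hu.1], by linarith [hu.2]⟩
  set k : ℤ := ⌊a / T⌋ with hk
  have hk1 : k * T ≤ a := (le_div_iff₀ hT).1 (Int.floor_le _)
  have hk2 : a ≤ k * T + T := by
    have := (div_lt_iff₀ hT).1 (Int.lt_floor_add_one (a / T))
    linarith
  have hunion : BoundedVariationOn f (Icc (k * T) (k * T + T + T)) := by
    have h := eVariationOn.Icc_add_Icc f (s := univ) (show (k : ℝ) * T ≤ k * T + T by linarith)
      (show (k : ℝ) * T + T ≤ k * T + T + T by linarith) (mem_univ _)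
    simp only [univ_inter] at h
    have h' := shift (k + 1)
    push_cast at h'
    rw [add_mul, one_mul] at h'
    rw [BoundedVariationOn, ← h]
    exact ENNReal.add_ne_top.2 ⟨shift k, h'⟩
  exact hunion.mono (Icc_subset_Icc hk1 (by linarith))

/-- Partial Fourier sums are convolutions with the Dirichlet kernel. -/
lemma sum_fourierCoeff_eq_integral_dirichletKernel {f : ℝ → ℂ}
    (hf : IntervalIntegrable f volume 0 (2 * π)) (x : ℝ) (N : ℕ) :
    ∑ n ∈ Finset.Icc (-(N : ℤ)) (N : ℤ),
        ((1 / (2 * (π : ℂ))) *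
            ∫ t in (0 : ℝ)..(2 * π), f t * Complex.exp (-Complex.I * (n : ℂ) * (t : ℂ))) *
          Complex.exp (Complex.I * (n : ℂ) * (x : ℂ)) =
      (1 / (2 * (π : ℂ))) *
        ∫ t in (0 : ℝ)..(2 * π), f t * (dirichletKernel N (t - x) : ℂ) := by
  simp_rw [mul_assoc (1 / (2 * (π : ℂ)))]
  rw [← Finset.mul_sum]
  congr 1
  simp_rw [← intervalIntegral.integral_mul_const]
  rw [← intervalIntegral.integral_finsetSum]
  · refine intervalIntegral.integral_congr fun t _ => ?_
    rw [← dirichletKernel_neg, ← sum_exp_eq_dirichletKernel, Finset.mul_sum]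
    refine Finset.sum_congr rfl fun n _ => ?_
    rw [mul_assoc, ← Complex.exp_add]
    congr 2
    push_cast
    ring
  · intro n _
    exact (hf.mul_continuousOn (by fun_prop)).mul_const _

/-- Symmetrization of the convolution with the Dirichlet kernel about the point `x`. -/
lemma Function.Periodic.integral_mul_dirichletKernel_sub {f : ℝ → ℂ}
    (hper : Function.Periodic f (2 * π)) (x : ℝ)
    (hf : IntervalIntegrable f volume (x - π) (x + π)) (N : ℕ) :
    ∫ t in (0 : ℝ)..(2 * π), f t * (dirichletKernel N (t - x) : ℂ) =
      (∫ u in (0 : ℝ)..π, f (x + u) * (dirichletKernel N u : ℂ)) +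
        ∫ u in (0 : ℝ)..π, f (x - u) * (dirichletKernel N u : ℂ) := by
  have hpi := Real.pi_pos
  have hF : Function.Periodic (fun t => f t * (dirichletKernel N (t - x) : ℂ)) (2 * π) := by
    intro t
    dsimp only
    rw [hper t, add_sub_right_comm, periodic_dirichletKernel N]
  have hc := continuous_dirichletKernel N
  have hint : IntervalIntegrable (fun t => f t * (dirichletKernel N (t - x) : ℂ)) volume
      (x - π) (x + π) := hf.mul_continuousOn (by fun_prop)
  have hsub : ∀ c d, c ∈ Icc (x - π) (x + π) → d ∈ Icc (x - π) (x + π) →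
      IntervalIntegrable (fun t => f t * (dirichletKernel N (t - x) : ℂ)) volume c d := by
    intro c d h h'
    rw [← uIcc_of_le (by linarith)] at h h'
    exact hint.mono_set (uIcc_subset_uIcc h h')
  have h1 := hF.intervalIntegral_add_eq 0 (x - π)
  rw [zero_add, show x - π + 2 * π = x + π by ring] at h1
  have hx : x ∈ Icc (x - π) (x + π) := ⟨by linarith, by linarith⟩
  rw [h1, ← intervalIntegral.integral_add_adjacent_intervals
    (hsub _ x ⟨le_rfl, by linarith⟩ hx) (hsub x _ hx ⟨by linarith, le_rfl⟩), add_comm]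
  congr 1
  · have := intervalIntegral.integral_comp_add_left (a := 0) (b := π)
      (fun t => f t * (dirichletKernel N (t - x) : ℂ)) x
    simpa using this.symm
  · have := intervalIntegral.integral_comp_sub_left (a := 0) (b := π)
      (fun t => f t * (dirichletKernel N (t - x) : ℂ)) x
    simpa [dirichletKernel_neg] using this.symm

/-- Dirichlet's convergence theorem for Fourier series (bounded variation form): if
`f : ℝ → ℂ` is `2π`-periodic and of bounded variation on `[0, 2π]`, and has right
limit `Lp` and left limit `Lm` at `x`, then the symmetric partial sums
`S_N f(x) = ∑_{n=-N}^{N} c_n(f) e^{inx}` converge to `(Lp + Lm)/2`, where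
`c_n(f) = (1/(2π)) ∫₀^{2π} f(t) e^{-int} dt`. -/
theorem dirichlet_fourier_convergence (f : ℝ → ℂ)
    (hper : Function.Periodic f (2 * π))
    (hbv : BoundedVariationOn f (Set.Icc 0 (2 * π)))
    (x : ℝ) (Lp Lm : ℂ)
    (hR : Filter.Tendsto f (nhdsWithin x (Set.Ioi x)) (nhds Lp))
    (hL : Filter.Tendsto f (nhdsWithin x (Set.Iio x)) (nhds Lm)) :
    Filter.Tendsto
      (fun N : ℕ => ∑ n ∈ Finset.Icc (-(N : ℤ)) (N : ℤ),
        ((1 / (2 * (π : ℂ))) *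
            ∫ t in (0 : ℝ)..(2 * π), f t * Complex.exp (-Complex.I * (n : ℂ) * (t : ℂ))) *
          Complex.exp (Complex.I * (n : ℂ) * (x : ℂ)))
      Filter.atTop (nhds ((Lp + Lm) / 2)) := by
  have hpi := Real.pi_pos
  have hf0 : IntervalIntegrable f volume 0 (2 * π) := hbv.intervalIntegrable (by positivity)
  have hbvx : BoundedVariationOn f (Icc (x - π) (x + π)) := by
    have := hper.boundedVariationOn_Icc (by positivity) hbv (x - π)
    rwa [show x - π + 2 * π = x + π by ring] at this
  have hfx : IntervalIntegrable f volume (x - π) (x + π) :=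
    hbvx.intervalIntegrable (by linarith)
  have hbvR : BoundedVariationOn (fun u => f (x + u)) (Icc 0 π) :=
    ne_top_of_le_ne_top hbvx (eVariationOn.comp_le_of_monotoneOn f (fun u => x + u)
      (fun u _ v _ huv => by dsimp only; linarith)
      fun u hu => ⟨by linarith [hu.1], by linarith [hu.2]⟩)
  have hbvL : BoundedVariationOn (fun u => f (x - u)) (Icc 0 π) :=
    ne_top_of_le_ne_top hbvx (eVariationOn.comp_le_of_antitoneOn f (fun u => x - u)
      (fun u _ v _ huv => by dsimp only; linarith)
      fun u hu => ⟨by linarith [hu.2], by linarith [hu.1]⟩)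
  have hlimR : Tendsto (fun u => f (x + u)) (𝓝[>] 0) (𝓝 Lp) := by
    refine hR.comp (tendsto_nhdsWithin_iff.2 ⟨?_, ?_⟩)
    · have : Continuous fun u : ℝ => x + u := by fun_prop
      simpa using (this.tendsto 0).mono_left nhdsWithin_le_nhds
    · filter_upwards [self_mem_nhdsWithin] with u hu
      simpa using hu
  have hlimL : Tendsto (fun u => f (x - u)) (𝓝[>] 0) (𝓝 Lm) := by
    refine hL.comp (tendsto_nhdsWithin_iff.2 ⟨?_, ?_⟩)
    · have : Continuous fun u : ℝ => x - u := by fun_prop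
      simpa using (this.tendsto 0).mono_left nhdsWithin_le_nhds
    · filter_upwards [self_mem_nhdsWithin] with u hu
      simpa using hu
  have h := ((hbvR.tendsto_integral_mul_dirichletKernel hlimR).add
    (hbvL.tendsto_integral_mul_dirichletKernel hlimL)).const_mul (1 / (2 * (π : ℂ)))
  have hlim : 1 / (2 * (π : ℂ)) * (π * Lp + π * Lm) = (Lp + Lm) / 2 := by
    have : (π : ℂ) ≠ 0 := by exact_mod_cast hpi.ne'
    field_simp
  rw [hlim] at h
  refine h.congr fun N => ?_
  rw [sum_fourierCoeff_eq_integral_dirichletKernel hf0,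
    hper.integral_mul_dirichletKernel_sub x hfx]
end
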